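/- arXiv:2604.27535 — 2 statements merged into one kernel-verified Lean document; each statement's English description precedes it below -/
import Mathlib

section
/- Let n ≥ 3 and let 𝒢 = {G_1, …, G_n} be a family of n graphs (not necessarily distinct) on a common vertex set V with |V| = n. If σ(𝒢) ≥ n, then either every vertex of V is contained in a rainbow cycle of length ℓ for every ℓ with 4 ≤ ℓ ≤ n, or n is even and G_1 = ⋯ = G_n = K_{n/2,n/2}. -/
/-- `c`, `φ` encode a rainbow cycle of length `ℓ` in the graph family `G`:
`c` lists the vertices of the cycle in cyclic order (injectively), and `φ`
injectively assigns to the edge `c i — c (i+1)` a member of the family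
containing it. -/
def IsRainbowCycle {V ι : Type*} {ℓ : ℕ} (G : ι → SimpleGraph V)
    (c : ZMod ℓ → V) (φ : ZMod ℓ → ι) : Prop :=
  Function.Injective c ∧ Function.Injective φ ∧
    ∀ i : ZMod ℓ, (G (φ i)).Adj (c i) (c (i + 1))

/-- The family `G` contains a rainbow cycle of length `ℓ`. -/
def HasRainbowCycle {V ι : Type*} (G : ι → SimpleGraph V) (ℓ : ℕ) : Prop :=
  ∃ (c : ZMod ℓ → V) (φ : ZMod ℓ → ι), IsRainbowCycle G c φ

/-- The family `G` contains a rainbow cycle of length `ℓ` passing through `x`. -/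
def HasRainbowCycleThrough {V ι : Type*} (G : ι → SimpleGraph V) (ℓ : ℕ) (x : V) : Prop :=
  ∃ (c : ZMod ℓ → V) (φ : ZMod ℓ → ι), IsRainbowCycle G c φ ∧ ∃ i, c i = x

namespace RB

open Finset

/-- Rainbow cycle of length `ℓ` with vertex set exactly `S`. -/
def RC {V C : Type*} (A : C → V → V → Prop) (ℓ : ℕ) (S : Set V) : Prop :=
  ∃ (c : ZMod ℓ → V) (φ : ZMod ℓ → C), Function.Injective c ∧ Function.Injective φ ∧
    (∀ i, A (φ i) (c i) (c (i + 1))) ∧ Set.range c = S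

open Classical in
/-- Degree of `u` in colour `p`. -/
noncomputable def D {V C : Type*} [Fintype V] (A : C → V → V → Prop) (p : C) (u : V) : ℕ :=
  (univ.filter (fun v => A p u v)).card

/-- The standing hypotheses. -/
structure Good {V C : Type*} [Fintype V] (A : C → V → V → Prop) : Prop where
  symm : ∀ c u v, A c u v → A c v u
  irr : ∀ c u, ¬ A c u u
  ore : ∀ u v, u ≠ v → (∃ c, ¬ A c u v) → ∀ p q, Fintype.card V ≤ D A p u + D A q v

lemma RC_of_fun {V C : Type*} {A : C → V → V → Prop} (p : ℕ) (w : ℕ → V) (κ : ℕ → C)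
    (hw : ∀ i j, i ≤ p → j ≤ p → w i = w j → i = j)
    (hκ : ∀ i j, i ≤ p → j ≤ p → κ i = κ j → i = j)
    (hA : ∀ i, i < p → A (κ i) (w i) (w (i + 1)))
    (hc : A (κ p) (w p) (w 0)) : RC A (p + 1) (w '' Set.Iic p) := by
  refine ⟨fun z => w z.val, fun z => κ z.val, ?_, ?_, ?_, ?_⟩
  · intro a b h
    have := hw _ _ (Nat.lt_succ_iff.mp (ZMod.val_lt a)) (Nat.lt_succ_iff.mp (ZMod.val_lt b)) h
    exact ZMod.val_injective _ this
  · intro a b h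
    have := hκ _ _ (Nat.lt_succ_iff.mp (ZMod.val_lt a)) (Nat.lt_succ_iff.mp (ZMod.val_lt b)) h
    exact ZMod.val_injective _ this
  · intro z
    have hz := ZMod.val_lt z
    rcases Nat.lt_or_ge z.val p with h | h
    · have h1 : (z + 1).val = z.val + 1 := by
        by_cases hp : p = 0
        · omega
        have : (1 : ZMod (p + 1)).val = 1 := by
          rw [ZMod.val_one_eq_one_mod]; exact Nat.mod_eq_of_lt (by omega)
        rw [ZMod.val_add_of_lt, this]
        rw [this]; omega
      simp only [h1]
      exact hA _ h
    · have h2 : z.val = p := by omega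
      have h1 : (z + 1) = 0 := by
        rw [← ZMod.natCast_zmod_val z, h2]
        have := ZMod.natCast_self (p + 1)
        push_cast at this
        exact this
      simp only [h1, h2, ZMod.val_zero]
      exact hc
  · ext v
    constructor
    · rintro ⟨z, rfl⟩
      exact ⟨z.val, Nat.lt_succ_iff.mp (ZMod.val_lt z), rfl⟩
    · rintro ⟨i, hi, rfl⟩
      refine ⟨(i : ZMod (p + 1)), ?_⟩
      simp only
      rw [ZMod.val_natCast_of_lt (Nat.lt_succ_iff.mpr hi)]

/-- Crossing exchange on a path `w 0, …, w p`. -/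
lemma exch {V C : Type*} {A : C → V → V → Prop} (hs : ∀ c u v, A c u v → A c v u)
    (p : ℕ) (w : ℕ → V) (κ : ℕ → C)
    (hw : ∀ i j, i ≤ p → j ≤ p → w i = w j → i = j)
    (hκ : ∀ i j, i < p → j < p → κ i = κ j → i = j)
    (hA : ∀ i, i < p → A (κ i) (w i) (w (i + 1)))
    (k : ℕ) (hk : k < p) (f g : C) (hfg : f ≠ g) (hf : ∀ i, i < p → κ i ≠ f)
    (hg : ∀ i, i < p → i ≠ k → κ i ≠ g)
    (h1 : A f (w 0) (w (k + 1))) (h2 : A g (w p) (w k)) :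
    RC A (p + 1) (w '' Set.Iic p) := by
  have key := RC_of_fun (A := A) p (fun i => if i ≤ k then w i else w (p + k + 1 - i))
    (fun i => if i < k then κ i else if i = k then g else if i < p then κ (p + k - i) else f)
    ?_ ?_ ?_ ?_
  · have : (fun i => if i ≤ k then w i else w (p + k + 1 - i)) '' Set.Iic p = w '' Set.Iic p := by
      ext v
      constructor
      · rintro ⟨i, hi, rfl⟩
        simp only [Set.mem_Iic] at hi
        by_cases h : i ≤ k
        · exact ⟨i, hi, by simp [h]⟩
        · exact ⟨p + k + 1 - i, by simp only [Set.mem_Iic]; omega, by simp [h]⟩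
      · rintro ⟨i, hi, rfl⟩
        simp only [Set.mem_Iic] at hi
        by_cases h : i ≤ k
        · exact ⟨i, hi, by simp [h]⟩
        · refine ⟨p + k + 1 - i, by simp only [Set.mem_Iic]; omega, ?_⟩
          have h3 : ¬ (p + k + 1 - i ≤ k) := by omega
          have h4 : p + k + 1 - (p + k + 1 - i) = i := by omega
          simp only [h3, if_false, h4]
    rw [this] at key
    exact key
  · intro i j hi hj h
    try simp only at h
    split_ifs at h with h3 h4 h4
    · exact hw _ _ hi hj h
    · have := hw _ _ (by omega) (by omega) h; omega
    · have := hw _ _ (by omega) (by omega) h; omega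
    · have := hw _ _ (by omega) (by omega) h; omega
  · intro i j hi hj h
    try simp only at h
    split_ifs at h <;> first
      | omega
      | (have := hκ _ _ (by omega) (by omega) h; omega)
      | exact absurd h (hf _ (by omega))
      | exact absurd h.symm (hf _ (by omega))
      | exact absurd h (hg _ (by omega) (by omega))
      | exact absurd h.symm (hg _ (by omega) (by omega))
      | exact absurd h hfg
      | exact absurd h.symm hfg
  · intro i hi
    try simp only
    rcases lt_trichotomy i k with h | h | h
    · simp only [h, h.le, if_true, show i + 1 ≤ k by omega]
      exact hA i hi
    · subst h
      simp only [le_refl, lt_irrefl, if_true, if_false, show ¬ (i + 1 ≤ i) by omega,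
        show p + i + 1 - (i + 1) = p by omega]
      exact hs _ _ _ h2
    · simp only [show ¬ i ≤ k by omega, show ¬ i < k by omega, show i ≠ k by omega, hi, if_true,
        if_false, show ¬ i + 1 ≤ k by omega, show p + k + 1 - (i + 1) = p + k - i by omega,
        show p + k + 1 - i = (p + k - i) + 1 by omega]
      exact hs _ _ _ (hA _ (by omega))
  · simp only [show ¬ p ≤ k by omega, show ¬ p < k by omega, show p ≠ k by omega, if_true,
        if_false, lt_irrefl, Nat.zero_le, show p + k + 1 - p = k + 1 by omega]
    exact hs _ _ _ h1

open Classical in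
/-- Counting: no rainbow cycle on the vertex set of the path forces common outside neighbours. -/
lemma cross {V C : Type*} [Fintype V] {A : C → V → V → Prop} (hG : Good A)
    (p : ℕ) (hp : 1 ≤ p) (w : ℕ → V) (κ : ℕ → C)
    (hw : ∀ i j, i ≤ p → j ≤ p → w i = w j → i = j)
    (hκ : ∀ i j, i < p → j < p → κ i = κ j → i = j)
    (hA : ∀ i, i < p → A (κ i) (w i) (w (i + 1)))
    (f g : C) (hfg : f ≠ g) (hf : ∀ i, i < p → κ i ≠ f)
    (hg : ∀ i, i < p → κ i ≠ g)
    (hno : ¬ RC A (p + 1) (w '' Set.Iic p)) :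
    1 ≤ (univ.filter (fun q => (∀ i, i ≤ p → w i ≠ q) ∧ A f (w 0) q ∧ A g (w p) q)).card ∧
    ∀ k, k < p → ¬ A f (w 0) (w (k + 1)) → ¬ A g (w p) (w k) →
    2 ≤ (univ.filter (fun q => (∀ i, i ≤ p → w i ≠ q) ∧ A f (w 0) q ∧ A g (w p) q)).card := by
  have hclose : ¬ A f (w 0) (w p) := by
    intro h
    apply hno
    refine RC_of_fun p w (fun i => if i < p then κ i else f) hw ?_ ?_ ?_
    · intro i j hi hj h
      try simp only at h
      split_ifs at h <;> first
      | omega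
      | (have := hκ _ _ (by omega) (by omega) h; omega)
      | exact absurd h (hf _ (by omega))
      | exact absurd h.symm (hf _ (by omega))
    · intro i hi
      simp only [hi, if_true]; exact hA i hi
    · simp only [lt_irrefl, if_false]
      exact hG.symm _ _ _ h
  have hne : w 0 ≠ w p := fun h => by have := hw _ _ (by omega) le_rfl h; omega
  have hdeg := hG.ore _ _ hne ⟨f, hclose⟩ f g
  set P : Finset V := (range (p + 1)).image w with hP
  have hPc : P.card = p + 1 := by
    rw [hP, card_image_of_injOn, card_range]
    intro i hi j hj h
    simp only [coe_range, Set.mem_Iio] at hi hj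
    exact hw _ _ (by omega) (by omega) h
  set Q : Finset V := univ.filter (fun q => ∀ i, i ≤ p → w i ≠ q) with hQ
  have hQP : Q = Pᶜ := by
    ext q
    simp only [hQ, hP, mem_filter, mem_univ, true_and, mem_compl, mem_image, mem_range, not_exists,
      not_and, Nat.lt_succ_iff, ne_eq]
  have hQc : Q.card + (p + 1) = Fintype.card V := by
    rw [hQP, ← hPc]
    exact card_compl_add_card P
  set S := univ.filter (fun q => (∀ i, i ≤ p → w i ≠ q) ∧ A f (w 0) q ∧ A g (w p) q) with hS
  set X := (range p).filter (fun k => A f (w 0) (w (k + 1))) with hX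
  set Y := (range p).filter (fun k => A g (w p) (w k)) with hY
  set X' := Q.filter (fun q => A f (w 0) q) with hX'
  set Y' := Q.filter (fun q => A g (w p) q) with hY'
  have hDf : D A f (w 0) ≤ X.card + X'.card := by
    have : univ.filter (fun v => A f (w 0) v) ⊆ X.image (fun k => w (k + 1)) ∪ X' := by
      intro v hv
      simp only [mem_filter, mem_univ, true_and] at hv
      by_cases hq : v ∈ Q
      · exact mem_union_right _ (by simp [hX', hq, hv])
      · apply mem_union_left
        simp only [hQ, mem_filter, mem_univ, true_and, not_forall, not_not] at hq
        obtain ⟨i, hi, rfl⟩ := hq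
        rcases Nat.eq_zero_or_pos i with h0 | h0
        · subst h0; exact absurd hv (hG.irr _ _)
        · refine mem_image.mpr ⟨i - 1, ?_, by congr 1; omega⟩
          rw [hX, mem_filter, mem_range]
          exact ⟨by omega, by rwa [show i - 1 + 1 = i by omega]⟩
    calc D A f (w 0) ≤ _ := by unfold D; exact card_le_card this
      _ ≤ _ := card_union_le _ _
      _ ≤ _ := Nat.add_le_add_right card_image_le _
  have hDg : D A g (w p) ≤ Y.card + Y'.card := by
    have : univ.filter (fun v => A g (w p) v) ⊆ Y.image (fun k => w k) ∪ Y' := by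
      intro v hv
      simp only [mem_filter, mem_univ, true_and] at hv
      by_cases hq : v ∈ Q
      · exact mem_union_right _ (by simp [hY', hq, hv])
      · apply mem_union_left
        simp only [hQ, mem_filter, mem_univ, true_and, not_forall, not_not] at hq
        obtain ⟨i, hi, rfl⟩ := hq
        rcases Nat.lt_or_ge i p with h0 | h0
        · refine mem_image.mpr ⟨i, ?_, rfl⟩
          rw [hY, mem_filter, mem_range]
          exact ⟨h0, hv⟩
        · have : i = p := by omega
          subst this; exact absurd hv (hG.irr _ _)
    calc D A g (w p) ≤ _ := by unfold D; exact card_le_card this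
      _ ≤ _ := card_union_le _ _
      _ ≤ _ := Nat.add_le_add_right card_image_le _
  have hdis : Disjoint X Y := by
    rw [disjoint_left]
    intro k hk1 hk2
    simp only [hX, hY, mem_filter, mem_range] at hk1 hk2
    exact hno (exch hG.symm p w κ hw hκ hA k hk1.1 f g hfg hf (fun i hi _ => hg i hi) hk1.2 hk2.2)
  have hXY : (X ∪ Y).card = X.card + Y.card := card_union_of_disjoint hdis
  have hsub : X ∪ Y ⊆ range p :=
    union_subset (filter_subset _ _) (filter_subset _ _)
  have hinter : X' ∩ Y' = S := by
    ext q
    simp only [hX', hY', hS, hQ, mem_inter, mem_filter, mem_univ, true_and]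
    tauto
  have hie := card_union_add_card_inter X' Y'
  rw [hinter] at hie
  have hle : (X' ∪ Y').card ≤ Q.card :=
    card_le_card (union_subset (filter_subset _ _) (filter_subset _ _))
  refine ⟨?_, ?_⟩
  · have := card_le_card hsub
    rw [card_range] at this
    omega
  · intro k hk h1 h2
    have : X ∪ Y ⊂ range p := by
      refine ⟨hsub, fun h => ?_⟩
      have := h (mem_range.mpr hk)
      simp only [hX, hY, mem_union, mem_filter] at this
      tauto
    have := card_lt_card this
    rw [card_range] at this
    omega


lemma image_univ_of_card {V : Type*} [Fintype V] (p : ℕ) (w : ℕ → V)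
    (hw : ∀ i j, i ≤ p → j ≤ p → w i = w j → i = j) (hV : Fintype.card V = p + 1) :
    w '' Set.Iic p = Set.univ := by
  classical
  have h1 : ((range (p + 1)).image w).card = p + 1 := by
    rw [card_image_of_injOn, card_range]
    intro i hi j hj h
    simp only [coe_range, Set.mem_Iio] at hi hj
    exact hw _ _ (by omega) (by omega) h
  have h2 : (range (p + 1)).image w = univ := by
    rw [← card_eq_iff_eq_univ, h1, hV]
  ext v
  simp only [Set.mem_univ, iff_true]
  have h3 : v ∈ (range (p + 1)).image w := by rw [h2]; exact mem_univ _
  obtain ⟨i, hi, rfl⟩ := mem_image.mp h3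
  exact ⟨i, by simpa [Nat.lt_succ_iff] using hi, rfl⟩

lemma exchI {V C : Type*} [Fintype V] {A : C → V → V → Prop} (hs : ∀ c u v, A c u v → A c v u)
    (M : ℕ) (hV : Fintype.card V = M + 2) (v : ℕ → V) (u : ℕ → C) (y : V) (f g : C)
    (hv : ∀ i j, i ≤ M → j ≤ M → v i = v j → i = j)
    (hu : ∀ i j, i < M → j < M → u i = u j → i = j)
    (hA : ∀ i, i < M → A (u i) (v i) (v (i + 1)))
    (hy : ∀ i, i ≤ M → v i ≠ y) (hfg : f ≠ g) (hf : ∀ i, i < M → u i ≠ f)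
    (hg : ∀ i, i < M → u i ≠ g) (k : ℕ) (hk : k < M)
    (h1 : A f y (v 0)) (h2 : A (u k) (v k) (v M)) (h3 : A g y (v (k + 1))) :
    RC A (M + 2) Set.univ := by
  have hw : ∀ i j, i ≤ M + 1 → j ≤ M + 1 → (if i = 0 then y else v (i - 1)) =
      (if j = 0 then y else v (j - 1)) → i = j := by
    intro i j hi hj h
    split_ifs at h <;> first
      | omega
      | (have := hv _ _ (by omega) (by omega) h; omega)
      | exact absurd h (hy _ (by omega))
      | exact absurd h.symm (hy _ (by omega))
  rw [← image_univ_of_card (M + 1) (fun i => if i = 0 then y else v (i - 1)) hw hV]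
  refine exch hs (M + 1) _ (fun i => if i = 0 then f else u (i - 1)) hw ?_ ?_ (k + 1) (by omega)
    g (u k) (hg k hk).symm ?_ ?_ ?_ ?_
  · intro i j hi hj h
    try simp only at h
    split_ifs at h <;> first
      | omega
      | (have := hu _ _ (by omega) (by omega) h; omega)
      | exact absurd h (hf _ (by omega))
      | exact absurd h.symm (hf _ (by omega))
  · intro i hi
    rcases Nat.eq_zero_or_pos i with h | h
    · subst h; simpa using h1
    · obtain ⟨i, rfl⟩ : ∃ i', i = i' + 1 := ⟨i - 1, by omega⟩
      simpa using hA i (by omega)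
  · intro i hi
    try simp only
    split_ifs
    · exact hfg
    · exact hg _ (by omega)
  · intro i hi hik
    try simp only
    split_ifs
    · exact (hf k hk).symm
    · intro h
      have := hu _ _ (by omega) hk h
      omega
  · simpa using h3
  · simpa using hs _ _ _ h2

lemma exchA {V C : Type*} [Fintype V] {A : C → V → V → Prop} (hs : ∀ c u v, A c u v → A c v u)
    (M : ℕ) (hV : Fintype.card V = M + 2) (v : ℕ → V) (u : ℕ → C) (y : V) (f g : C)
    (hv : ∀ i j, i ≤ M → j ≤ M → v i = v j → i = j)
    (hu : ∀ i j, i < M → j < M → u i = u j → i = j)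
    (hA : ∀ i, i < M → A (u i) (v i) (v (i + 1)))
    (hy : ∀ i, i ≤ M → v i ≠ y) (hfg : f ≠ g) (hf : ∀ i, i < M → u i ≠ f)
    (hg : ∀ i, i < M → u i ≠ g) (j k : ℕ) (hj : j < M) (hk : k < M) (hkj : k ≠ j)
    (h1 : A f y (v j)) (h2 : A g y (v (j + 1))) (h3 : A (u k) (v k) (v M))
    (h4 : A (u j) (v 0) (v (k + 1))) :
    RC A (M + 2) Set.univ := by
  have hw : ∀ a b, a ≤ M + 1 → b ≤ M + 1 →
      (if a ≤ j then v a else if a = j + 1 then y else v (a - 1)) =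
      (if b ≤ j then v b else if b = j + 1 then y else v (b - 1)) → a = b := by
    intro a b ha hb h
    split_ifs at h <;> first
      | omega
      | (have := hv _ _ (by omega) (by omega) h; omega)
      | exact absurd h (hy _ (by omega))
      | exact absurd h.symm (hy _ (by omega))
  rw [← image_univ_of_card (M + 1)
    (fun a => if a ≤ j then v a else if a = j + 1 then y else v (a - 1)) hw hV]
  refine exch hs (M + 1) _
    (fun a => if a < j then u a else if a = j then f else if a = j + 1 then g else u (a - 1))
    hw ?_ ?_ (if k < j then k else k + 1) (by split_ifs <;> omega)
    (u j) (u k) (fun h => hkj (hu _ _ hk hj h.symm)) ?_ ?_ ?_ ?_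
  · intro a b ha hb h
    try simp only at h
    split_ifs at h <;> first
      | omega
      | (have := hu _ _ (by omega) (by omega) h; omega)
      | exact absurd h (hf _ (by omega))
      | exact absurd h.symm (hf _ (by omega))
      | exact absurd h (hg _ (by omega))
      | exact absurd h.symm (hg _ (by omega))
      | exact absurd h hfg
      | exact absurd h.symm hfg
  · intro a ha
    rcases lt_trichotomy a j with h | h | h
    · simp only [h, h.le, if_true, show a + 1 ≤ j by omega]
      exact hA a (by omega)
    · subst h
      simp only [le_refl, if_true, lt_irrefl, if_false, show ¬ a + 1 ≤ a by omega]
      exact hs _ _ _ h1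
    · by_cases h' : a = j + 1
      · subst h'
        simp only [show ¬ j + 1 < j by omega, show ¬ j + 1 ≤ j by omega, show ¬ j + 1 + 1 ≤ j by omega,
          show j + 1 ≠ j by omega, show j + 1 + 1 ≠ j + 1 by omega, if_true, if_false,
          show j + 1 + 1 - 1 = j + 1 by omega]
        exact h2
      · simp only [show ¬ a < j by omega, show ¬ a ≤ j by omega, show ¬ a + 1 ≤ j by omega,
          show a ≠ j by omega, h', show a + 1 ≠ j + 1 by omega, if_false,
          show a + 1 - 1 = a by omega]
        have := hA (a - 1) (by omega)
        rwa [show a - 1 + 1 = a by omega] at this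
  · intro a ha
    try simp only
    split_ifs
    · intro h; have := hu _ _ (by omega) (by omega) h; omega
    · exact (hf j hj).symm
    · exact (hg j hj).symm
    · intro h; have := hu _ _ (by omega) (by omega) h; omega
  · intro a ha hak
    try simp only
    split_ifs at hak ⊢ <;> first
      | exact (hf k hk).symm
      | exact (hg k hk).symm
      | (intro h; have := hu _ _ (by omega) (by omega) h; omega)
  · by_cases h : k < j
    · simp only [h, if_true, show k + 1 ≤ j by omega, Nat.zero_le]
      exact h4
    · simp only [h, if_false, if_true, show ¬ k + 1 + 1 ≤ j by omega, Nat.zero_le,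
        show k + 1 + 1 ≠ j + 1 by omega, show k + 1 + 1 - 1 = k + 1 by omega]
      exact h4
  · by_cases h : k < j
    · simp only [h, if_true, h.le, show ¬ M + 1 ≤ j by omega, show M + 1 ≠ j + 1 by omega, if_false,
        show M + 1 - 1 = M by omega]
      exact hs _ _ _ h3
    · simp only [h, if_false, show ¬ M + 1 ≤ j by omega, show M + 1 ≠ j + 1 by omega,
        show M + 1 - 1 = M by omega, show ¬ k + 1 ≤ j by omega, show k + 1 ≠ j + 1 by omega,
        show k + 1 - 1 = k by omega]
      exact hs _ _ _ h3

lemma cast_inj_lt {m : ℕ} (s : ZMod m) {i j : ℕ} (hi : i < m) (hj : j < m)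
    (h : s + (i : ZMod m) = s + (j : ZMod m)) : i = j := by
  have h' := add_left_cancel h
  rw [ZMod.natCast_eq_natCast_iff] at h'
  exact Nat.ModEq.eq_of_lt_of_lt h' hi hj

/-- every element `k ≠ s` of `ZMod (M+1)` is `s + 1 + t` with `t < M`. -/
lemma exists_off {M : ℕ} (s k : ZMod (M + 1)) (h : k ≠ s) :
    ∃ t : ℕ, t < M ∧ k = s + 1 + (t : ZMod (M + 1)) := by
  refine ⟨(k - s - 1).val, ?_, ?_⟩
  · have h1 := ZMod.val_lt (k - s - 1)
    rcases Nat.lt_or_ge (k - s - 1).val M with h2 | h2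
    · exact h2
    · exfalso
      have h3 : (k - s - 1).val = M := by omega
      have h4 : k - s - 1 = (M : ZMod (M + 1)) :=
        (ZMod.natCast_zmod_val (k - s - 1)).symm.trans (congrArg _ h3)
      have h5 := ZMod.natCast_self (M + 1)
      push_cast at h5
      apply h
      have : k - s = 0 := by rw [← h5, ← h4]; ring
      exact sub_eq_zero.mp this
  · rw [ZMod.natCast_zmod_val]; ring

lemma wrap {M : ℕ} (s : ZMod (M + 1)) : s + 1 + (M : ZMod (M + 1)) = s := by
  have h5 := ZMod.natCast_self (M + 1)
  push_cast at h5
  rw [add_assoc, add_comm 1, h5, add_zero]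

lemma exchI' {V C : Type*} [Fintype V] {A : C → V → V → Prop} (hs : ∀ c u v, A c u v → A c v u)
    (M : ℕ) (hV : Fintype.card V = M + 2) (c : ZMod (M + 1) → V) (φ : ZMod (M + 1) → C) (y : V)
    (f0 : C) (hc : Function.Injective c) (hφ : Function.Injective φ)
    (hA : ∀ i, A (φ i) (c i) (c (i + 1))) (hy : ∀ i, c i ≠ y) (hf0 : ∀ i, φ i ≠ f0)
    (s k : ZMod (M + 1)) (hks : k ≠ s) (f g : C) (hfg : f = f0 ∧ g = φ s ∨ f = φ s ∧ g = f0)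
    (h1 : A f y (c (s + 1))) (h2 : A (φ k) (c k) (c s)) (h3 : A g y (c (k + 1))) :
    RC A (M + 2) Set.univ := by
  obtain ⟨t, ht, rfl⟩ := exists_off s k hks
  have hs' : ∀ i : ℕ, i < M → φ (s + 1 + i) ≠ φ s := by
    intro i hi h
    have h2 := hφ h
    have := cast_inj_lt (s + 1) (i := i) (j := M) (by omega) (by omega) (h2.trans (wrap s).symm)
    omega
  refine exchI hs M hV (fun i => c (s + 1 + i)) (fun i => φ (s + 1 + i)) y f g ?_ ?_ ?_ ?_ ?_ ?_ ?_
    t ht ?_ ?_ ?_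
  · intro i j hi hj h
    exact cast_inj_lt (s + 1) (by omega) (by omega) (hc h)
  · intro i j hi hj h
    exact cast_inj_lt (s + 1) (by omega) (by omega) (hφ h)
  · intro i hi
    have := hA (s + 1 + i)
    simpa [add_assoc] using this
  · intro i _; exact hy _
  · rcases hfg with ⟨rfl, rfl⟩ | ⟨rfl, rfl⟩
    · exact (hf0 s).symm
    · exact hf0 s
  · intro i hi
    rcases hfg with ⟨rfl, rfl⟩ | ⟨rfl, rfl⟩
    · exact hf0 _
    · exact hs' i hi
  · intro i hi
    rcases hfg with ⟨rfl, rfl⟩ | ⟨rfl, rfl⟩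
    · exact hs' i hi
    · exact hf0 _
  · simpa using h1
  · simp only [wrap]; exact h2
  · simpa [add_assoc] using h3

lemma exchA' {V C : Type*} [Fintype V] {A : C → V → V → Prop} (hs : ∀ c u v, A c u v → A c v u)
    (M : ℕ) (hV : Fintype.card V = M + 2) (c : ZMod (M + 1) → V) (φ : ZMod (M + 1) → C) (y : V)
    (f0 : C) (hc : Function.Injective c) (hφ : Function.Injective φ)
    (hA : ∀ i, A (φ i) (c i) (c (i + 1))) (hy : ∀ i, c i ≠ y) (hf0 : ∀ i, φ i ≠ f0)
    (s j k : ZMod (M + 1)) (hjs : j ≠ s) (hks : k ≠ s) (hkj : k ≠ j)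
    (h1 : A f0 y (c j)) (h2 : A (φ s) y (c (j + 1))) (h3 : A (φ k) (c k) (c s))
    (h4 : A (φ j) (c (s + 1)) (c (k + 1))) :
    RC A (M + 2) Set.univ := by
  obtain ⟨t, ht, rfl⟩ := exists_off s k hks
  obtain ⟨r, hr, rfl⟩ := exists_off s j hjs
  have hs' : ∀ i : ℕ, i < M → φ (s + 1 + i) ≠ φ s := by
    intro i hi h
    have h2 := hφ h
    have := cast_inj_lt (s + 1) (i := i) (j := M) (by omega) (by omega) (h2.trans (wrap s).symm)
    omega
  refine exchA hs M hV (fun i => c (s + 1 + i)) (fun i => φ (s + 1 + i)) y f0 (φ s)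
    ?_ ?_ ?_ ?_ ?_ ?_ ?_ r t hr ht ?_ ?_ ?_ ?_ ?_
  · intro i j hi hj h
    exact cast_inj_lt (s + 1) (by omega) (by omega) (hc h)
  · intro i j hi hj h
    exact cast_inj_lt (s + 1) (by omega) (by omega) (hφ h)
  · intro i hi
    have := hA (s + 1 + i)
    simpa [add_assoc] using this
  · intro i _; exact hy _
  · exact (hf0 s).symm
  · intro i hi; exact hf0 _
  · intro i hi; exact hs' i hi
  · rintro rfl; exact hkj rfl
  · exact h1
  · simpa [add_assoc] using h2
  · simp only [wrap]; exact h3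
  · simpa [add_assoc] using h4


/-- Minimum degree of `v` over all colours. -/
noncomputable def dl {V C : Type*} [Fintype V] (A : C → V → V → Prop) (v : V) : ℕ :=
  sInf (Set.range (fun p => D A p v))

lemma dl_le {V C : Type*} [Fintype V] (A : C → V → V → Prop) (v : V) (p : C) :
    dl A v ≤ D A p v := Nat.sInf_le ⟨p, rfl⟩

lemma dl_mem {V C : Type*} [Fintype V] [Nonempty C] (A : C → V → V → Prop) (v : V) :
    ∃ p, D A p v = dl A v := Nat.sInf_mem (Set.range_nonempty (fun p => D A p v))

lemma dl_ore {V C : Type*} [Fintype V] {A : C → V → V → Prop} (hG : Good A) (u v : V)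
    (huv : u ≠ v) (c : C) (h : ¬ A c u v) : Fintype.card V ≤ dl A u + dl A v := by
  have : Nonempty C := ⟨c⟩
  obtain ⟨p, hp⟩ := dl_mem A u
  obtain ⟨q, hq⟩ := dl_mem A v
  rw [← hp, ← hq]
  exact hG.ore u v huv ⟨c, h⟩ p q

lemma sum_dl {V C : Type*} [Fintype V] [Nonempty V] [Nonempty C] {A : C → V → V → Prop}
    (hG : Good A) : (Fintype.card V) ^ 2 ≤ 2 * ∑ v, dl A v + 1 := by
  classical
  obtain ⟨u, -, hu⟩ := exists_min_image (univ : Finset V) (dl A) univ_nonempty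
  set n := Fintype.card V with hn
  set b := dl A u with hb
  by_cases h2 : n ≤ 2 * b
  · have : n * b ≤ ∑ v, dl A v := by
      have := card_nsmul_le_sum (univ : Finset V) (dl A) b hu
      simpa [hn] using this
    nlinarith
  · obtain ⟨e, he⟩ : ∃ e, n = 2 * b + e := ⟨n - 2 * b, by omega⟩
    obtain ⟨p, hp⟩ := dl_mem A u
    set M := univ.filter (fun v => v ≠ u ∧ ∃ c, ¬ A c u v) with hM
    have hMc : n ≤ M.card + 1 + b := by
      have hsub : (univ : Finset V) ⊆ (M ∪ {u}) ∪ univ.filter (fun v => A p u v) := by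
        intro v _
        by_cases hv : A p u v
        · exact mem_union_right _ (by simp [hv])
        · apply mem_union_left
          by_cases hvu : v = u
          · exact mem_union_right _ (by simp [hvu])
          · exact mem_union_left _ (by simp only [hM, mem_filter, mem_univ, true_and]; exact ⟨hvu, p, hv⟩)
      calc n = (univ : Finset V).card := hn
        _ ≤ _ := card_le_card hsub
        _ ≤ _ := card_union_le _ _
        _ ≤ M.card + 1 + b := by
          apply Nat.add_le_add
          · exact (card_union_le _ _).trans (by simp)
          · rw [hb, ← hp]; unfold D; exact le_of_eq (by congr)
    have hS : n * b + M.card * e ≤ ∑ v, dl A v := by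
      calc n * b + M.card * e = ∑ v, (b + if v ∈ M then e else 0) := by
            rw [sum_add_distrib]
            simp [hn]
        _ ≤ _ := by
          apply sum_le_sum
          intro v _
          split_ifs with hv
          · simp only [hM, mem_filter, mem_univ, true_and] at hv
            obtain ⟨hvu, c, hc⟩ := hv
            have := dl_ore hG u v hvu.symm c hc
            omega
          · simpa using hu v (mem_univ _)
    have h3 : b + e ≤ M.card + 1 := by omega
    have h4 : (b + e) * e ≤ (M.card + 1) * e := Nat.mul_le_mul_right _ h3
    rw [he] at hS ⊢
    nlinarith [sq_nonneg ((e : ℤ) - 1), (by zify; nlinarith [sq_nonneg ((e : ℤ) - 1)] : 2 * e ≤ e * e + 1)]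

lemma card_filter_cyc {V : Type*} [Fintype V] (M : ℕ) (hV : Fintype.card V = M + 2)
    (c : ZMod (M + 1) → V) (hc : Function.Injective c) (y : V) (hy : ∀ i, c i ≠ y) (v : V)
    (hv : v ≠ y) : ∃ i, c i = v := by
  classical
  by_contra hcon
  push Not at hcon
  have h1 : (univ.image c) ⊆ (univ.erase y).erase v := by
    intro z hz
    obtain ⟨i, -, rfl⟩ := mem_image.mp hz
    simp [hy i, hcon i]
  have := card_le_card h1
  rw [card_image_of_injective _ hc, card_erase_of_mem (by simp [hv]), card_erase_of_mem (by simp)] at this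
  simp [ZMod.card, hV] at this

lemma card_two {α : Type*} [DecidableEq α] (X Y U : Finset α) (hX : X ⊆ U) (hY : Y ⊆ U)
    (h : ∀ k, k ∈ X → k ∈ Y → False) : X.card + Y.card ≤ U.card := by
  rw [← card_union_of_disjoint (disjoint_left.mpr fun a ha hb => h a ha hb)]
  exact card_le_card (union_subset hX hY)

/-- Extending an almost spanning rainbow cycle. -/
lemma extend {V C : Type*} [Fintype V] [Fintype C] {A : C → V → V → Prop} (hG : Good A)
    (M : ℕ) (hV : Fintype.card V = M + 2) (hC : Fintype.card C = M + 2) (y : V)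
    (hyd : M + 2 ≤ 2 * dl A y) (hM : 1 ≤ M)
    (hR : RC A (M + 1) {y}ᶜ) : RC A (M + 2) Set.univ := by
  classical
  obtain ⟨c, φ, hc, hφ, hA, hr⟩ := hR
  have hy : ∀ i, c i ≠ y := by
    intro i h
    have : c i ∈ ({y}ᶜ : Set V) := by rw [← hr]; exact ⟨i, rfl⟩
    exact this h
  obtain ⟨f0, hf0⟩ : ∃ f0, ∀ i, φ i ≠ f0 := by
    by_contra hcon
    push Not at hcon
    have := Fintype.card_le_of_surjective φ hcon
    simp [ZMod.card, hC] at this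
  by_contra hno
  have : Nonempty V := ⟨y⟩
  have : Nonempty C := ⟨f0⟩
  have : Fact (1 < M + 1) := ⟨by omega⟩
  have hsum := sum_dl hG
  rw [hV] at hsum
  set a := dl A y with ha
  have hcard : Fintype.card (ZMod (M + 1)) = M + 1 := ZMod.card _
  have hcov := card_filter_cyc M hV c hc y hy
  have hNy : ∀ f, (univ.filter (fun i => A f y (c i))).card = D A f y := by
    intro f
    unfold D
    rw [← card_image_of_injective _ hc]
    congr 1
    ext v
    simp only [mem_image, mem_filter, mem_univ, true_and]
    constructor
    · rintro ⟨i, h, rfl⟩; exact h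
    · intro h
      obtain ⟨i, rfl⟩ := hcov v (fun e => hG.irr f y (e ▸ h))
      exact ⟨i, h, rfl⟩
  have hNy' : ∀ f, (univ.filter (fun i => A f y (c (i + 1)))).card = D A f y := by
    intro f
    rw [← hNy f]
    apply card_bij (fun i _ => i + 1)
    · intro i hi; simpa using hi
    · intro i _ j _ h; exact add_right_cancel h
    · intro i hi
      exact ⟨i - 1, by simpa using hi, by ring⟩
  set T : ZMod (M + 1) → ℕ := fun s => (univ.filter (fun k => k ≠ s ∧ A (φ k) (c k) (c s))).card with hT
  set d := D A f0 y with hd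
  have had : a ≤ d := dl_le A y f0
  set J := (univ.filter (fun k => A (φ k) (c k) y)) with hJ
  have hJd : J.card + d ≤ M + 1 := by
    rw [hd, ← hNy' f0]
    refine (card_two _ _ _ (subset_univ _) (subset_univ _) ?_).trans (le_of_eq hcard)
    intro k h1 h2
    simp only [hJ, mem_filter, mem_univ, true_and] at h1 h2
    have hk1 : k - 1 ≠ k := by
      intro h
      have : (1 : ZMod (M + 1)) = 0 := by
        have := sub_eq_self.mp h
        exact this
      exact one_ne_zero this
    exact hno (exchI' hG.symm M hV c φ y f0 hc hφ hA hy hf0 k (k - 1) hk1 f0 (φ k)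
      (Or.inl ⟨rfl, rfl⟩) h2 (by simpa using hA (k - 1)) (by simpa using hG.symm _ _ _ h1))
  have hbound1 : ∀ s f g, (f = f0 ∧ g = φ s ∨ f = φ s ∧ g = f0) → A f y (c (s + 1)) →
      T s + a ≤ M + 1 := by
    intro s f g hfg h1
    have h2 := card_two (univ.filter (fun k => k ≠ s ∧ A (φ k) (c k) (c s)))
      ((univ.filter (fun i => A g y (c (i + 1)))).erase s) (univ.erase s)
      (by intro k; simp; tauto) (erase_subset_erase _ (subset_univ _))
      (by
        intro k hk1 hk2
        simp only [mem_filter, mem_univ, true_and, mem_erase] at hk1 hk2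
        exact hno (exchI' hG.symm M hV c φ y f0 hc hφ hA hy hf0 s k hk1.1 f g hfg h1 hk1.2 hk2.2))
    rw [card_erase_of_mem (mem_univ _), card_univ, hcard] at h2
    have h3 := pred_card_le_card_erase (s := univ.filter (fun i => A g y (c (i + 1)))) (a := s)
    rw [hNy' g] at h3
    have h4 := dl_le A y g
    have h5 : T s = (univ.filter (fun k => k ≠ s ∧ A (φ k) (c k) (c s))).card := rfl
    omega
  have hbound2 : ∀ s, ¬ A f0 y (c (s + 1)) → T s ≤ a := by
    intro s hs
    by_cases hs' : A (φ s) y (c (s + 1))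
    · have := hbound1 s (φ s) f0 (Or.inr ⟨rfl, rfl⟩) hs'
      omega
    ·
      obtain ⟨j, hjs, hj1, hj2⟩ : ∃ j, j ≠ s ∧ A f0 y (c j) ∧ A (φ s) y (c (j + 1)) := by
        by_contra hcon
        push Not at hcon
        have h2 := card_two ((univ.filter (fun i => A f0 y (c i))).erase s)
          (univ.filter (fun i => A (φ s) y (c (i + 1)))) (univ.erase s)
          (erase_subset_erase _ (subset_univ _))
          (by
            intro k hk
            simp only [mem_filter, mem_univ, true_and] at hk
            simp only [mem_erase, mem_univ, and_true]
            rintro rfl; exact hs' hk)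
          (by
            intro k hk1 hk2
            simp only [mem_filter, mem_univ, true_and, mem_erase] at hk1 hk2
            exact hcon k hk1.1 hk1.2 hk2)
        rw [card_erase_of_mem (mem_univ _), card_univ, hcard, hNy'] at h2
        have h3 := pred_card_le_card_erase (s := univ.filter (fun i => A f0 y (c i))) (a := s)
        rw [hNy] at h3
        have h4 := dl_le A y f0
        have h5 := dl_le A y (φ s)
        omega
      have hore := dl_ore hG y (c (s + 1)) (hy _).symm f0 hs
      have hD := dl_le A (c (s + 1)) (φ j)
      have h2 := card_two ((univ.filter (fun k => k ≠ s ∧ A (φ k) (c k) (c s))).erase j)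
        ((univ.filter (fun k => k ≠ s ∧ A (φ j) (c (s + 1)) (c (k + 1)))).erase j)
        ((univ.erase s).erase j)
        (erase_subset_erase _ (by intro k; simp; tauto))
        (erase_subset_erase _ (by intro k; simp; tauto))
        (by
          intro k hk1 hk2
          simp only [mem_filter, mem_univ, true_and, mem_erase] at hk1 hk2
          exact hno (exchA' hG.symm M hV c φ y f0 hc hφ hA hy hf0 s j k hjs hk1.2.1 hk1.1
            hj1 hj2 hk1.2.2 hk2.2.2))
      rw [card_erase_of_mem (show j ∈ univ.erase s by simp [hjs]), card_erase_of_mem (mem_univ s),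
        card_univ, hcard] at h2
      have h3 := pred_card_le_card_erase (s := univ.filter (fun k => k ≠ s ∧ A (φ k) (c k) (c s))) (a := j)
      have h4 := pred_card_le_card_erase
        (s := univ.filter (fun k => k ≠ s ∧ A (φ j) (c (s + 1)) (c (k + 1)))) (a := j)
      have h5 : D A (φ j) (c (s + 1)) ≤
          (univ.filter (fun k => k ≠ s ∧ A (φ j) (c (s + 1)) (c (k + 1)))).card + 1 := by
        unfold D
        have : univ.filter (fun v => A (φ j) (c (s + 1)) v) ⊆
            (univ.filter (fun k => k ≠ s ∧ A (φ j) (c (s + 1)) (c (k + 1)))).image (fun k => c (k + 1))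
              ∪ {y} := by
          intro v hv
          simp only [mem_filter, mem_univ, true_and] at hv
          by_cases hvy : v = y
          · exact mem_union_right _ (by simp [hvy])
          · apply mem_union_left
            obtain ⟨i, rfl⟩ := hcov v hvy
            refine mem_image.mpr ⟨i - 1, ?_, by simp⟩
            simp only [mem_filter, mem_univ, true_and, sub_add_cancel]
            refine ⟨?_, hv⟩
            rintro rfl
            rw [sub_add_cancel] at hv
            exact hG.irr _ _ hv
        refine (card_le_card this).trans ((card_union_le _ _).trans ?_)
        rw [card_singleton]
        exact Nat.add_le_add_right card_image_le _
      have h6 : T s = (univ.filter (fun k => k ≠ s ∧ A (φ k) (c k) (c s))).card := rfl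
      have h7 : 2 ≤ M + 1 := by omega
      omega
  have haM : a ≤ M + 1 := by omega
  have hup : ∑ s, T s ≤ d * (M + 1 - a) + (M + 1 - d) * a := by
    calc ∑ s, T s ≤ ∑ s, (if A f0 y (c (s + 1)) then (M + 1 - a) else a) := by
          apply sum_le_sum
          intro s _
          split_ifs with h
          · have := hbound1 s f0 (φ s) (Or.inl ⟨rfl, rfl⟩) h
            omega
          · exact hbound2 s h
      _ = _ := by
          rw [sum_ite, sum_const, sum_const, hNy' f0, ← hd, smul_eq_mul, smul_eq_mul]
          congr 2
          have := card_filter_add_card_filter_not (s := (univ : Finset (ZMod (M + 1))))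
            (fun s => A f0 y (c (s + 1)))
          rw [hNy' f0, card_univ, hcard] at this
          omega
  have hlow : ∑ k, dl A (c k) ≤ ∑ s, T s + J.card := by
    have h1 : ∑ s, T s = ∑ k, (univ.filter (fun s => k ≠ s ∧ A (φ k) (c k) (c s))).card := by
      simp only [hT, card_filter]
      exact sum_comm
    have h2 : J.card = ∑ k, (if A (φ k) (c k) y then 1 else 0) := by
      rw [hJ, card_filter]
    rw [h1, h2, ← sum_add_distrib]
    apply sum_le_sum
    intro k _
    refine (dl_le A (c k) (φ k)).trans ?_
    unfold D
    have : univ.filter (fun v => A (φ k) (c k) v) ⊆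
        (univ.filter (fun s => k ≠ s ∧ A (φ k) (c k) (c s))).image c
          ∪ (if A (φ k) (c k) y then {y} else ∅) := by
      intro v hv
      simp only [mem_filter, mem_univ, true_and] at hv
      by_cases hvy : v = y
      · subst hvy; exact mem_union_right _ (by simp [hv])
      · apply mem_union_left
        obtain ⟨i, rfl⟩ := hcov v hvy
        refine mem_image.mpr ⟨i, ?_, rfl⟩
        simp only [mem_filter, mem_univ, true_and]
        refine ⟨?_, hv⟩
        rintro rfl
        exact hG.irr _ _ hv
    refine (card_le_card this).trans ((card_union_le _ _).trans ?_)
    apply Nat.add_le_add card_image_le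
    split_ifs <;> simp
  have hsplit : ∑ v, dl A v = a + ∑ k, dl A (c k) := by
    have h1 : (univ : Finset V) = insert y (univ.image c) := by
      ext v
      simp only [mem_univ, mem_insert, mem_image, true_and, true_iff]
      by_cases h : v = y
      · exact Or.inl h
      · exact Or.inr (hcov v h)
    rw [h1, sum_insert (by simp [hy]), sum_image (fun i _ j _ h => hc h)]
  have hdM : d ≤ M + 1 := by omega
  obtain ⟨a', ha'⟩ : ∃ a', M + 1 = a + a' := ⟨M + 1 - a, by omega⟩
  obtain ⟨d', hd'⟩ : ∃ d', M + 1 = d + d' := ⟨M + 1 - d, by omega⟩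
  rw [show M + 1 - a = a' by omega, show M + 1 - d = d' by omega] at hup
  have hJ' : J.card ≤ d' := by omega
  have hfin : ∑ v, dl A v ≤ a + (d * a' + d' * a) + d' := by omega
  obtain ⟨e, he⟩ : ∃ e, a = a' + 1 + e := ⟨a - a' - 1, by omega⟩
  obtain ⟨g, hg⟩ : ∃ g, d = a + g := ⟨d - a, by omega⟩
  have hg' : a' = d' + g := by omega
  have hM2 : M + 2 = 2 * d' + 2 * g + e + 2 := by omega
  rw [hM2] at hsum
  rw [hg, he, hg'] at hfin
  nlinarith [Nat.zero_le (e * g), Nat.zero_le (g * g), Nat.zero_le (e * e), Nat.zero_le (g * d')]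


lemma ham_of_path {V C : Type*} [Fintype V] [Fintype C] {A : C → V → V → Prop} (hG : Good A)
    (M : ℕ) (hM : 1 ≤ M) (hV : Fintype.card V = M + 2) (hC : Fintype.card C = M + 2)
    (w : ℕ → V) (κ : ℕ → C)
    (hw : ∀ i j, i ≤ M + 1 → j ≤ M + 1 → w i = w j → i = j)
    (hκ : ∀ i j, i < M + 1 → j < M + 1 → κ i = κ j → i = j)
    (hA : ∀ i, i < M + 1 → A (κ i) (w i) (w (i + 1)))
    (g : C) (hg : ∀ i, i < M + 1 → κ i ≠ g) (hn : ¬ A g (w 0) (w (M + 1)))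
    (hi : M + 2 ≤ 2 * dl A (w 0)) : RC A (M + 2) Set.univ := by
  classical
  refine extend hG M hV hC (w 0) hi hM ?_
  have hcov := image_univ_of_card (M + 1) w hw hV
  have himg : (fun i => w (i + 1)) '' Set.Iic M = {w 0}ᶜ := by
    ext v
    simp only [Set.mem_image, Set.mem_Iic, Set.mem_compl_iff, Set.mem_singleton_iff]
    constructor
    · rintro ⟨i, hi, rfl⟩ h
      have := hw _ _ (by omega) (by omega) h
      omega
    · intro h
      obtain ⟨i, hi, rfl⟩ : v ∈ w '' Set.Iic (M + 1) := by rw [hcov]; trivial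
      simp only [Set.mem_Iic] at hi
      rcases Nat.eq_zero_or_pos i with h0 | h0
      · subst h0; exact absurd rfl h
      · exact ⟨i - 1, by omega, by congr 1; omega⟩
  rw [← himg]
  by_contra hno
  have := (cross hG M hM (fun i => w (i + 1)) (fun i => κ (i + 1)) ?_ ?_ ?_ (κ 0) g ?_ ?_ ?_ hno).1
  · obtain ⟨q, hq⟩ := card_pos.mp this
    simp only [mem_filter, mem_univ, true_and] at hq
    obtain ⟨hq1, hq2, hq3⟩ := hq
    have hq0 : q = w 0 := by
      by_contra h
      have : q ∈ (fun i => w (i + 1)) '' Set.Iic M := by rw [himg]; exact h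
      obtain ⟨i, hi, h⟩ := this
      exact hq1 i hi h
    subst hq0
    exact hn (hG.symm _ _ _ hq3)
  · intro i j hi hj h
    have := hw _ _ (by omega) (by omega) h; omega
  · intro i j hi hj h
    have := hκ _ _ (by omega) (by omega) h; omega
  · intro i hi
    exact hA (i + 1) (by omega)
  · exact hg 0 (by omega)
  · intro i hi h
    have := hκ _ _ (by omega) (by omega) h; omega
  · intro i hi
    exact hg _ (by omega)

lemma ham_of_path' {V C : Type*} [Fintype V] [Fintype C] {A : C → V → V → Prop} (hG : Good A)
    (M : ℕ) (hM : 1 ≤ M) (hV : Fintype.card V = M + 2) (hC : Fintype.card C = M + 2)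
    (w : ℕ → V) (κ : ℕ → C)
    (hw : ∀ i j, i ≤ M + 1 → j ≤ M + 1 → w i = w j → i = j)
    (hκ : ∀ i j, i < M + 1 → j < M + 1 → κ i = κ j → i = j)
    (hA : ∀ i, i < M + 1 → A (κ i) (w i) (w (i + 1)))
    (g : C) (hg : ∀ i, i < M + 1 → κ i ≠ g) (hn : ¬ A g (w 0) (w (M + 1))) :
    RC A (M + 2) Set.univ := by
  have hne : w 0 ≠ w (M + 1) := fun h => by
    have := hw _ _ (by omega) le_rfl h; omega
  have hore := dl_ore hG _ _ hne g hn
  by_cases h : M + 2 ≤ 2 * dl A (w 0)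
  · exact ham_of_path hG M hM hV hC w κ hw hκ hA g hg hn h
  · refine ham_of_path hG M hM hV hC (fun i => w (M + 1 - i)) (fun i => κ (M - i)) ?_ ?_ ?_ g ?_ ?_ ?_
    · intro i j hi hj h
      have := hw _ _ (by omega) (by omega) h; omega
    · intro i j hi hj h
      have := hκ _ _ (by omega) (by omega) h; omega
    · intro i hi
      have := hA (M - i) (by omega)
      rw [show M + 1 - (i + 1) = M - i by omega, show M + 1 - i = M - i + 1 by omega]
      exact hG.symm _ _ _ this
    · intro i hi; exact hg _ (by omega)
    · simp only [Nat.sub_self, Nat.sub_zero]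
      exact fun h => hn (hG.symm _ _ _ h)
    · simp only [Nat.sub_zero]; omega

open Classical in
theorem ham {V C : Type*} [Fintype V] [Fintype C] (M : ℕ) (hM : 1 ≤ M)
    (hV : Fintype.card V = M + 2) (hC : Fintype.card C = M + 2) :
    ∀ (N : ℕ) (A : C → V → V → Prop), Good A →
      (univ.filter (fun t : C × V × V => t.2.1 ≠ t.2.2 ∧ ¬ A t.1 t.2.1 t.2.2)).card = N →
      RC A (M + 2) Set.univ := by
  intro N
  induction N using Nat.strong_induction_on with
  | _ N ih =>
  intro A hG hN
  by_cases hcomp : ∀ c u v, u ≠ v → A c u v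
  · have e : ZMod (M + 2) ≃ V := Fintype.equivOfCardEq (by rw [ZMod.card, hV])
    have e' : ZMod (M + 2) ≃ C := Fintype.equivOfCardEq (by rw [ZMod.card, hC])
    have : Fact (1 < M + 2) := ⟨by omega⟩
    exact ⟨e, e', e.injective, e'.injective, fun i => hcomp _ _ _ (fun h => by
      have := e.injective h
      exact one_ne_zero (left_eq_add.mp this)), e.range_eq_univ⟩
  · push Not at hcomp
    obtain ⟨c0, u0, v0, huv, hn⟩ := hcomp
    set A' : C → V → V → Prop := fun c u v =>
      A c u v ∨ (c = c0 ∧ (u = u0 ∧ v = v0 ∨ u = v0 ∧ v = u0)) with hA'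
    have hsub : ∀ c u v, A c u v → A' c u v := fun c u v h => Or.inl h
    have hD : ∀ p u, D A p u ≤ D A' p u := by
      intro p u
      unfold D
      exact card_le_card (fun v hv => by
        simp only [mem_filter, mem_univ, true_and] at hv ⊢
        exact hsub _ _ _ hv)
    have hG' : Good A' := by
      refine ⟨?_, ?_, ?_⟩
      · rintro c u v (h | ⟨h1, h2⟩)
        · exact Or.inl (hG.symm _ _ _ h)
        · exact Or.inr ⟨h1, by tauto⟩
      · rintro c u (h | ⟨h1, h2 | h2⟩)
        · exact hG.irr _ _ h
        · exact huv (h2.1.symm.trans h2.2)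
        · exact huv (h2.2.symm.trans h2.1)
      · rintro u v huv ⟨c, hc⟩ p q
        have := hG.ore u v huv ⟨c, fun h => hc (hsub _ _ _ h)⟩ p q
        exact this.trans (Nat.add_le_add (hD _ _) (hD _ _))
    have hlt : (univ.filter (fun t : C × V × V => t.2.1 ≠ t.2.2 ∧ ¬ A' t.1 t.2.1 t.2.2)).card < N := by
      rw [← hN]
      apply card_lt_card
      refine ⟨?_, ?_⟩
      · intro t ht
        simp only [mem_filter, mem_univ, true_and] at ht ⊢
        exact ⟨ht.1, fun h => ht.2 (hsub _ _ _ h)⟩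
      · intro h
        have h1 : (c0, u0, v0) ∈
            univ.filter (fun t : C × V × V => t.2.1 ≠ t.2.2 ∧ ¬ A t.1 t.2.1 t.2.2) := by
          simp only [mem_filter, mem_univ, true_and]
          exact ⟨huv, hn⟩
        have h2 := h h1
        simp only [mem_filter, mem_univ, true_and] at h2
        exact h2.2 (Or.inr ⟨rfl, Or.inl ⟨rfl, rfl⟩⟩)
    obtain ⟨c, φ, hc, hφ, hAd, hr⟩ := ih _ hlt A' hG' (by congr!)
    by_cases hall : ∀ i, A (φ i) (c i) (c (i + 1))
    · exact ⟨c, φ, hc, hφ, hall, hr⟩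
    · push Not at hall
      obtain ⟨i, hi⟩ := hall
      have hi0 : φ i = c0 := by
        rcases hAd i with h | h
        · exact absurd h hi
        · exact h.1
      have hoth : ∀ j, j ≠ i → A (φ j) (c j) (c (j + 1)) := by
        intro j hj
        rcases hAd j with h | h
        · exact h
        · exact absurd (hφ (h.1.trans hi0.symm)) hj
      have hne : ∀ t : ℕ, t < M + 1 → i + 1 + (t : ZMod (M + 2)) ≠ i := by
        intro t ht h
        have := cast_inj_lt (i + 1) (i := t) (j := M + 1) (by omega) (by omega)
          (h.trans (wrap (M := M + 1) i).symm)
        omega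
      refine ham_of_path' hG M hM hV hC (fun t => c (i + 1 + t)) (fun t => φ (i + 1 + t)) ?_ ?_ ?_
        (φ i) ?_ ?_
      · intro a b ha hb h
        exact cast_inj_lt (i + 1) (by omega) (by omega) (hc h)
      · intro a b ha hb h
        exact cast_inj_lt (i + 1) (by omega) (by omega) (hφ h)
      · intro t ht
        have := hoth (i + 1 + t) (hne t ht)
        simpa [add_assoc] using this
      · intro t ht h
        exact hne t ht (hφ h)
      · intro h
        apply hi
        have h2 : c (i + 1 + ((M + 1 : ℕ) : ZMod (M + 2))) = c i := congrArg c (wrap (M := M + 1) i)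
        rw [h2] at h
        simpa using hG.symm _ _ _ h


lemma tail_cycle {V C : Type*} {A : C → V → V → Prop} (L : ℕ) (v : ℕ → V) (u : ℕ → C)
    (hv : ∀ s t, s ≤ t → t < s + (L + 6) → v s = v t → s = t)
    (hu : ∀ s t, s ≤ t → t < s + (L + 6) → u s = u t → s = t)
    (hA : ∀ t, A (u t) (v t) (v (t + 1))) (a1 a2 a3 : V) (g0 g1 g2 g3 : C)
    (h1 : ∀ t, 6 ≤ t → t ≤ L + 6 → v t ≠ a1) (h2 : ∀ t, 6 ≤ t → t ≤ L + 6 → v t ≠ a2)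
    (h3 : ∀ t, 6 ≤ t → t ≤ L + 6 → v t ≠ a3) (h12 : a1 ≠ a2) (h13 : a1 ≠ a3) (h23 : a2 ≠ a3)
    (k0 : ∀ t, 6 ≤ t → t < L + 6 → u t ≠ g0) (k1 : ∀ t, 6 ≤ t → t < L + 6 → u t ≠ g1)
    (k2 : ∀ t, 6 ≤ t → t < L + 6 → u t ≠ g2) (k3 : ∀ t, 6 ≤ t → t < L + 6 → u t ≠ g3)
    (k01 : g0 ≠ g1) (k02 : g0 ≠ g2) (k03 : g0 ≠ g3) (k12 : g1 ≠ g2) (k13 : g1 ≠ g3) (k23 : g2 ≠ g3)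
    (e0 : A g0 (v (L + 6)) a1) (e1 : A g1 a1 a2) (e2 : A g2 a2 a3) (e3 : A g3 a3 (v 6)) :
    ∃ S, RC A (L + 4) S ∧ v (L + 6) ∈ S := by
  refine ⟨_, RC_of_fun (L + 3)
    (fun i => if i ≤ L then v (i + 6) else if i = L + 1 then a1 else if i = L + 2 then a2 else a3)
    (fun i => if i < L then u (i + 6) else if i = L then g0 else if i = L + 1 then g1 else
      if i = L + 2 then g2 else g3) ?_ ?_ ?_ ?_, ⟨L, by simp, by simp⟩⟩
  · intro i j hi hj h
    try simp only at h
    split_ifs at h <;> first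
      | omega
      | (rcases Nat.le_total i j with hij | hij
         · have := hv _ _ (by omega) (by omega) h; omega
         · have := hv _ _ (by omega) (by omega) h.symm; omega)
      | exact absurd h (h1 _ (by omega) (by omega))
      | exact absurd h.symm (h1 _ (by omega) (by omega))
      | exact absurd h (h2 _ (by omega) (by omega))
      | exact absurd h.symm (h2 _ (by omega) (by omega))
      | exact absurd h (h3 _ (by omega) (by omega))
      | exact absurd h.symm (h3 _ (by omega) (by omega))
      | exact absurd h h12
      | exact absurd h.symm h12
      | exact absurd h h13
      | exact absurd h.symm h13
      | exact absurd h h23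
      | exact absurd h.symm h23
  · intro i j hi hj h
    try simp only at h
    split_ifs at h <;> first
      | omega
      | (rcases Nat.le_total i j with hij | hij
         · have := hu _ _ (by omega) (by omega) h; omega
         · have := hu _ _ (by omega) (by omega) h.symm; omega)
      | exact absurd h (k0 _ (by omega) (by omega))
      | exact absurd h.symm (k0 _ (by omega) (by omega))
      | exact absurd h (k1 _ (by omega) (by omega))
      | exact absurd h.symm (k1 _ (by omega) (by omega))
      | exact absurd h (k2 _ (by omega) (by omega))
      | exact absurd h.symm (k2 _ (by omega) (by omega))
      | exact absurd h (k3 _ (by omega) (by omega))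
      | exact absurd h.symm (k3 _ (by omega) (by omega))
      | exact absurd h k01
      | exact absurd h.symm k01
      | exact absurd h k02
      | exact absurd h.symm k02
      | exact absurd h k03
      | exact absurd h.symm k03
      | exact absurd h k12
      | exact absurd h.symm k12
      | exact absurd h k13
      | exact absurd h.symm k13
      | exact absurd h k23
      | exact absurd h.symm k23
  · intro i hi
    rcases lt_trichotomy i L with h | h | h
    · simp only [h, h.le, if_true, show i + 1 ≤ L by omega]
      have := hA (i + 6)
      rwa [show i + 6 + 1 = i + 1 + 6 by omega] at this
    · subst h
      simp only [le_refl, if_true, lt_irrefl, if_false, show ¬ i + 1 ≤ i by omega]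
      exact e0
    · obtain rfl | rfl : i = L + 1 ∨ i = L + 2 := by omega
      · simp only [show ¬ L + 1 ≤ L by omega, show ¬ L + 1 < L by omega, show L + 1 ≠ L by omega,
          show ¬ L + 1 + 1 ≤ L by omega, show L + 1 + 1 ≠ L + 1 by omega, if_true, if_false,
          show L + 1 + 1 = L + 2 by omega]
        exact e1
      · simp only [show ¬ L + 2 ≤ L by omega, show ¬ L + 2 < L by omega, show L + 2 ≠ L by omega,
          show ¬ L + 2 + 1 ≤ L by omega, show L + 2 ≠ L + 1 by omega, show L + 2 + 1 ≠ L + 1 by omega,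
          show L + 2 + 1 ≠ L + 2 by omega, if_true, if_false]
        exact e2
  · simp only [show ¬ L + 3 ≤ L by omega, show ¬ L + 3 < L by omega, show L + 3 ≠ L by omega,
      show L + 3 ≠ L + 1 by omega, show L + 3 ≠ L + 2 by omega, if_true, if_false, Nat.zero_le]
    exact e3

/-- From a rainbow cycle of length `ℓ + 2` through `x` to one of length `ℓ`, for `ℓ = L + 4`. -/
lemma reduce {V C : Type*} [Fintype V] {A : C → V → V → Prop} (hG : Good A) (L : ℕ) (x : V)
    (h : ∃ S, RC A (L + 6) S ∧ x ∈ S) : ∃ S, RC A (L + 4) S ∧ x ∈ S := by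
  classical
  obtain ⟨S, ⟨c, φ, hc, hφ, hA0, hr⟩, hx⟩ := h
  rw [← hr] at hx
  obtain ⟨i0, hi0⟩ := hx
  obtain ⟨v, hvdef⟩ : ∃ v : ℕ → V, ∀ t, v t = c (i0 + t) := ⟨_, fun _ => rfl⟩
  obtain ⟨u, hudef⟩ : ∃ u : ℕ → C, ∀ t, u t = φ (i0 + t) := ⟨_, fun _ => rfl⟩
  have hinj : ∀ s t : ℕ, s ≤ t → t < s + (L + 6) →
      i0 + (s : ZMod (L + 6)) = i0 + (t : ZMod (L + 6)) → s = t := by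
    intro s t hst hlt h
    have := cast_inj_lt (i0 + (s : ZMod (L + 6))) (i := 0) (j := t - s) (by omega) (by omega) (by
      rw [Nat.cast_sub hst, Nat.cast_zero]
      linear_combination h)
    omega
  have hv : ∀ s t, s ≤ t → t < s + (L + 6) → v s = v t → s = t := by
    intro s t h1 h2 h
    rw [hvdef, hvdef] at h
    exact hinj s t h1 h2 (hc h)
  have hu : ∀ s t, s ≤ t → t < s + (L + 6) → u s = u t → s = t := by
    intro s t h1 h2 h
    rw [hudef, hudef] at h
    exact hinj s t h1 h2 (hφ h)
  have hvne : ∀ s t, s < t → t < s + (L + 6) → v s ≠ v t := by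
    intro s t h1 h2 h
    have := hv s t h1.le h2 h; omega
  have hune : ∀ s t, s < t → t < s + (L + 6) → u s ≠ u t := by
    intro s t h1 h2 h
    have := hu s t h1.le h2 h; omega
  have hA : ∀ t, A (u t) (v t) (v (t + 1)) := by
    intro t
    rw [hudef, hvdef, hvdef]
    have := hA0 (i0 + t)
    push_cast
    rwa [add_assoc] at this
  have hvper : ∀ t, v (t + (L + 6)) = v t := by
    intro t
    rw [hvdef, hvdef]
    have := ZMod.natCast_self (L + 6)
    rw [Nat.cast_add, this, add_zero]
  have hxv : v (L + 6) = x := by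
    have := hvper 0
    rw [zero_add] at this
    rw [this, hvdef, Nat.cast_zero, add_zero, hi0]
  rw [← hxv]
  by_contra hno
  have hno' : ∀ S, v (L + 6) ∈ S → ¬ RC A (L + 4) S := fun S hS hR => hno ⟨S, hR, hS⟩
  have hb1 : ∀ b, (b = 1 ∨ b = 2) → _ := fun b hb =>
    cross hG (L + 3) (by omega) (fun i => v (i + 3)) (fun i => u (i + 3))
      (by
        intro i j hi hj h
        rcases Nat.le_total i j with hij | hij
        · have := hv _ _ (by omega) (by omega) h; omega
        · have := hv _ _ (by omega) (by omega) h.symm; omega)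
      (by
        intro i j hi hj h
        rcases Nat.le_total i j with hij | hij
        · have := hu _ _ (by omega) (by omega) h; omega
        · have := hu _ _ (by omega) (by omega) h.symm; omega)
      (by
        intro i hi
        have := hA (i + 3)
        rwa [show i + 3 + 1 = i + 1 + 3 by omega] at this)
      (u b) (u (L + 6)) (hune _ _ (by omega) (by omega))
      (fun i hi => (hune _ _ (by omega) (by omega)).symm)
      (fun i hi => hune _ _ (by omega) (by omega))
      (hno' _ ⟨L + 3, by simp, rfl⟩)
  have hb4 := cross hG (L + 3) (by omega) (fun i => v (i + 6)) (fun i => u (i + 6))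
      (by
        intro i j hi hj h
        rcases Nat.le_total i j with hij | hij
        · have := hv _ _ (by omega) (by omega) h; omega
        · have := hv _ _ (by omega) (by omega) h.symm; omega)
      (by
        intro i j hi hj h
        rcases Nat.le_total i j with hij | hij
        · have := hu _ _ (by omega) (by omega) h; omega
        · have := hu _ _ (by omega) (by omega) h.symm; omega)
      (by
        intro i hi
        have := hA (i + 6)
        rwa [show i + 6 + 1 = i + 1 + 6 by omega] at this)
      (u 5) (u 4) (hune _ _ (by omega) (by omega)).symm
      (fun i hi => (hune _ _ (by omega) (by omega)).symm)
      (fun i hi => (hune _ _ (by omega) (by omega)).symm)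
      (hno' _ ⟨L, by simp, rfl⟩)
  obtain ⟨q', hq'⟩ := card_pos.mp hb4.1
  simp only [mem_filter, mem_univ, true_and, zero_add] at hq'
  obtain ⟨hq'1, hq'2, hq'3⟩ := hq'
  rw [show L + 3 + 6 = 3 + (L + 6) by omega, hvper] at hq'3
  have hq'v3 : v 3 ≠ q' := by
    have := hq'1 (L + 3) le_rfl
    rwa [show L + 3 + 6 = 3 + (L + 6) by omega, hvper] at this
  have hq'v : ∀ t, 6 ≤ t → t ≤ L + 6 → v t ≠ q' := by
    intro t h1 h2
    have := hq'1 (t - 6) (by omega)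
    rwa [show t - 6 + 6 = t by omega] at this
  have hq_eq : ∀ q, (∀ t, 3 ≤ t → t ≤ L + 6 → v t ≠ q) → A (u 2) (v 3) q → A (u (L + 6)) (v (L + 6)) q →
      q = q' := by
    intro q h1 h2 h3
    by_contra hne
    apply hno
    refine tail_cycle L v u hv hu hA q (v 3) q' (u (L + 6)) (u 2) (u 4) (u 5)
      (fun t a b => h1 t (by omega) b) (fun t a b => (hvne _ _ (by omega) (by omega)).symm) hq'v
      (h1 3 le_rfl (by omega)).symm hne hq'v3 ?_ ?_ ?_ ?_ ?_ ?_ ?_ ?_ ?_ ?_ h3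
      (hG.symm _ _ _ h2) hq'3 (hG.symm _ _ _ hq'2) <;> first
      | exact fun t a b => (hune _ _ (by omega) (by omega))
      | exact fun t a b => (hune _ _ (by omega) (by omega)).symm
      | exact (hune _ _ (by omega) (by omega))
      | exact (hune _ _ (by omega) (by omega)).symm
  have hspec : ∀ b q, q ∈ univ.filter (fun q => (∀ i, i ≤ L + 3 → v (i + 3) ≠ q) ∧
      A (u b) (v (0 + 3)) q ∧ A (u (L + 6)) (v (L + 3 + 3)) q) →
      (∀ t, 3 ≤ t → t ≤ L + 6 → v t ≠ q) ∧ A (u b) (v 3) q ∧ A (u (L + 6)) (v (L + 6)) q := by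
    intro b q hq
    simp only [mem_filter, mem_univ, true_and, zero_add] at hq
    refine ⟨?_, hq.2.1, hq.2.2⟩
    intro t h1 h2
    have := hq.1 (t - 3) (by omega)
    rwa [show t - 3 + 3 = t by omega] at this
  obtain ⟨q, hq⟩ := card_pos.mp (hb1 2 (Or.inr rfl)).1
  obtain ⟨hqa, hqb, hqc⟩ := hspec _ _ hq
  have hqq' := hq_eq q hqa hqb hqc
  subst hqq'
  by_cases hE1 : A (u 2) (v 3) (v 5)
  · obtain ⟨r, hr⟩ := card_pos.mp (hb1 1 (Or.inl rfl)).1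
    obtain ⟨hra, hrb, hrc⟩ := hspec _ _ hr
    apply hno
    refine tail_cycle L v u hv hu hA r (v 3) (v 5) (u (L + 6)) (u 1) (u 2) (u 5)
      (fun t a b => hra t (by omega) b) (fun t a b => (hvne _ _ (by omega) (by omega)).symm)
      (fun t a b => (hvne _ _ (by omega) (by omega)).symm)
      (hra 3 le_rfl (by omega)).symm (hra 5 (by omega) (by omega)).symm
      (hvne _ _ (by omega) (by omega)) ?_ ?_ ?_ ?_ ?_ ?_ ?_ ?_ ?_ ?_ hrc
      (hG.symm _ _ _ hrb) hE1 (hA 5) <;> first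
      | exact fun t a b => (hune _ _ (by omega) (by omega))
      | exact fun t a b => (hune _ _ (by omega) (by omega)).symm
      | exact (hune _ _ (by omega) (by omega))
      | exact (hune _ _ (by omega) (by omega)).symm
  by_cases hE2 : A (u (L + 6)) (v (L + 6)) (v 4)
  · apply hno
    refine tail_cycle L v u hv hu hA (v 4) (v 3) q (u (L + 6)) (u 3) (u 4) (u 5)
      (fun t a b => (hvne _ _ (by omega) (by omega)).symm)
      (fun t a b => (hvne _ _ (by omega) (by omega)).symm)
      hq'v (hvne _ _ (by omega) (by omega)).symm (hqa 4 (by omega) (by omega)) hq'v3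
      ?_ ?_ ?_ ?_ ?_ ?_ ?_ ?_ ?_ ?_ hE2
      (hG.symm _ _ _ (hA 3)) hq'3 (hG.symm _ _ _ hq'2) <;> first
      | exact fun t a b => (hune _ _ (by omega) (by omega))
      | exact fun t a b => (hune _ _ (by omega) (by omega)).symm
      | exact (hune _ _ (by omega) (by omega))
      | exact (hune _ _ (by omega) (by omega)).symm
  have h2 := (hb1 2 (Or.inr rfl)).2 1 (by omega) hE1 hE2
  obtain ⟨r, s, hr, hs, hrs⟩ := one_lt_card_iff.mp (lt_of_lt_of_le one_lt_two h2)
  obtain ⟨hra, hrb, hrc⟩ := hspec _ _ hr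
  obtain ⟨hsa, hsb, hsc⟩ := hspec _ _ hs
  exact hrs ((hq_eq r hra hrb hrc).trans (hq_eq s hsa hsb hsc).symm)



lemma step {V C : Type*} [Fintype V] {A : C → V → V → Prop} (hG : Good A) (M : ℕ)
    (c : ZMod (M + 3) → V) (ψ : ZMod (M + 3) → C) (hc : Function.Injective c)
    (hsur : Function.Surjective c)
    (hψ : Function.Injective ψ) (hA : ∀ i, A (ψ i) (c i) (c (i + 1)))
    (hno : ∀ S, c 0 ∈ S → ¬ RC A (M + 2) S) (i : ZMod (M + 3)) (hi : i ≠ 0) :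
    (A (ψ (i - 1)) (c (i + 1)) (c i) ∧ A (ψ i) (c (i - 1)) (c i)) ∧
    ¬ A (ψ (i - 1)) (c (i - 1)) (c (i + 1)) ∧
    ∀ k : ℕ, k < M + 1 → (A (ψ (i - 1)) (c (i + 1)) (c (i + 2 + k)) ↔
      ¬ A (ψ i) (c (i - 1)) (c (i + 1 + k))) := by
  classical
  have hwr : i + 1 + ((M + 2 : ℕ) : ZMod (M + 3)) = i := wrap (M := M + 2) i
  have hwr1 : i + 1 + ((M + 1 : ℕ) : ZMod (M + 3)) = i - 1 := by
    have h := hwr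
    push_cast at h ⊢
    linear_combination h
  have hinj : ∀ s t : ℕ, s ≤ M + 2 → t ≤ M + 2 →
      i + 1 + (s : ZMod (M + 3)) = i + 1 + (t : ZMod (M + 3)) → s = t :=
    fun s t hs ht h => cast_inj_lt (i + 1) (by omega) (by omega) h
  have hw : ∀ s t : ℕ, s ≤ M + 1 → t ≤ M + 1 → c (i + 1 + s) = c (i + 1 + t) → s = t :=
    fun s t hs ht h => hinj s t (by omega) (by omega) (hc h)
  have hκ : ∀ s t : ℕ, s ≤ M + 1 → t ≤ M + 1 → ψ (i + 1 + s) = ψ (i + 1 + t) → s = t :=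
    fun s t hs ht h => hinj s t (by omega) (by omega) (hψ h)
  have hA' : ∀ t : ℕ, t < M + 1 → A (ψ (i + 1 + t)) (c (i + 1 + t)) (c (i + 1 + (t + 1 : ℕ))) := by
    intro t _
    have := hA (i + 1 + t)
    push_cast
    rwa [← add_assoc]
  have hx : c 0 ∈ (fun t : ℕ => c (i + 1 + t)) '' Set.Iic (M + 1) := by
    obtain ⟨t, ht, h⟩ := exists_off (M := M + 2) i 0 hi.symm
    refine ⟨t, ?_, ?_⟩
    · simp only [Set.mem_Iic]; omega
    · simp only; rw [h]
  have hn := hno _ hx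
  have hf : ∀ t : ℕ, t < M + 1 → ψ (i + 1 + t) ≠ ψ (i - 1) := by
    intro t ht h
    rw [← hwr1] at h
    have := hκ _ _ (by omega) (by omega) h
    omega
  have hg : ∀ t : ℕ, t < M + 1 → ψ (i + 1 + t) ≠ ψ i := by
    intro t ht h
    have := hinj _ _ (by omega) (by omega) ((hψ h).trans hwr.symm)
    omega
  have hfg : ψ (i - 1) ≠ ψ i := by
    intro h
    have := hinj (M + 1) (M + 2) (by omega) (by omega) (by rw [hwr1, hwr]; exact hψ h)
    omega
  have hcr := cross hG (M + 1) (by omega) (fun t : ℕ => c (i + 1 + t)) (fun t : ℕ => ψ (i + 1 + t))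
    hw (fun s t hs ht => hκ s t hs.le ht.le) hA' (ψ (i - 1)) (ψ i) hfg hf hg hn
  have hq : ∀ q, (∀ t : ℕ, t ≤ M + 1 → c (i + 1 + t) ≠ q) → q = c i := by
    intro q hq
    obtain ⟨z, rfl⟩ := hsur q
    by_contra hne
    have hz : z ≠ i := fun h => hne (by rw [h])
    obtain ⟨t, ht, h⟩ := exists_off (M := M + 2) i z hz
    exact hq t (by omega) (by rw [h])
  refine ⟨?_, ?_, ?_⟩
  · obtain ⟨q, hq1⟩ := card_pos.mp hcr.1
    simp only [mem_filter, mem_univ, true_and, hwr1, Nat.cast_zero, add_zero] at hq1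
    have := hq q hq1.1
    rw [this] at hq1
    exact hq1.2
  · intro h
    apply hn
    refine RC_of_fun (M + 1) (fun t : ℕ => c (i + 1 + t)) (fun t : ℕ => ψ (i + 1 + t)) hw hκ hA' ?_
    simp only [hwr1, Nat.cast_zero, add_zero]
    exact h
  · intro k hk
    have he : i + 2 + (k : ZMod (M + 3)) = i + 1 + ((k + 1 : ℕ) : ZMod (M + 3)) := by
      push_cast; ring
    constructor
    · intro h1 h2
      refine hn (exch hG.symm (M + 1) (fun t : ℕ => c (i + 1 + t)) (fun t : ℕ => ψ (i + 1 + t))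
        hw (fun s t hs ht => hκ s t hs.le ht.le) hA' k hk (ψ (i - 1)) (ψ i) hfg hf
        (fun t ht _ => hg t ht) ?_ ?_)
      · simp only [Nat.cast_zero, add_zero]
        rw [← he]; exact h1
      · simp only [hwr1]; exact h2
    · intro h2
      by_contra h1
      have h3 := hcr.2 k hk
        (by simp only [Nat.cast_zero, add_zero]; rw [← he]; exact h1)
        (by simp only [hwr1]; exact h2)
      obtain ⟨r, s, hr, hs, hrs⟩ := one_lt_card_iff.mp (lt_of_lt_of_le one_lt_two h3)
      simp only [mem_filter, mem_univ, true_and] at hr hs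
      exact hrs ((hq r hr.1).trans (hq s hs.1).symm)

lemma natCast_ne_zero_of {M t : ℕ} (h0 : 0 < t) (h1 : t < M) : ((t : ℕ) : ZMod M) ≠ 0 := by
  intro h
  rw [ZMod.natCast_eq_zero_iff] at h
  exact absurd (Nat.le_of_dvd h0 h) (by omega)

/-- Every colour appears on every edge of the Hamilton cycle. -/
lemma all_colours {V C : Type*} [Fintype V] {A : C → V → V → Prop} (hG : Good A) (M : ℕ)
    (c : ZMod (M + 3) → V) (hc : Function.Injective c)
    (hsur : Function.Surjective c) (hno : ∀ S, c 0 ∈ S → ¬ RC A (M + 2) S) (d : ℕ) :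
    ∀ (ψ : ZMod (M + 3) → C), Function.Injective ψ → (∀ i, A (ψ i) (c i) (c (i + 1))) →
    ∀ t : ℕ, t + d < M + 3 →
      A (ψ t) (c ((t + d : ℕ))) (c ((t + d : ℕ) + 1)) ∧ A (ψ ((t + d : ℕ))) (c t) (c (t + 1)) := by
  classical
  have hswap : ∀ (ψ : ZMod (M + 3) → C), Function.Injective ψ →
      (∀ i, A (ψ i) (c i) (c (i + 1))) → ∀ i, i ≠ 0 →
      ∀ j, A (ψ (Equiv.swap (i - 1) i j)) (c j) (c (j + 1)) := by
    intro ψ hψ hA i hi j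
    obtain ⟨⟨h1, h2⟩, -⟩ := step hG M c ψ hc hsur hψ hA hno i hi
    by_cases hj1 : j = i - 1
    · rw [hj1, Equiv.swap_apply_left, sub_add_cancel]
      exact h2
    by_cases hj2 : j = i
    · rw [hj2, Equiv.swap_apply_right]
      exact hG.symm _ _ _ h1
    · rw [Equiv.swap_apply_of_ne_of_ne hj1 hj2]
      exact hA j
  induction d with
  | zero =>
    intro ψ hψ hA t ht
    exact ⟨hA _, hA _⟩
  | succ d ih =>
    intro ψ hψ hA t ht
    constructor
    · have h0 : ((t + 1 : ℕ) : ZMod (M + 3)) ≠ 0 := natCast_ne_zero_of (by omega) (by omega)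
      have := (ih (fun j => ψ (Equiv.swap (((t + 1 : ℕ) : ZMod (M + 3)) - 1) ((t + 1 : ℕ)) j))
        (hψ.comp (Equiv.injective _)) (hswap ψ hψ hA _ h0) (t + 1) (by omega)).1
      rw [Equiv.swap_apply_right] at this
      rw [show t + 1 + d = t + (d + 1) by omega] at this
      rw [show (((t + 1 : ℕ) : ZMod (M + 3)) - 1) = t by push_cast; ring] at this
      exact this
    · have h0 : ((t + (d + 1) : ℕ) : ZMod (M + 3)) ≠ 0 := natCast_ne_zero_of (by omega) (by omega)
      have := (ih (fun j => ψ (Equiv.swap (((t + (d + 1) : ℕ) : ZMod (M + 3)) - 1)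
        ((t + (d + 1) : ℕ)) j))
        (hψ.comp (Equiv.injective _)) (hswap ψ hψ hA _ h0) t (by omega)).2
      rw [show ((t + d : ℕ) : ZMod (M + 3)) = (((t + (d + 1) : ℕ) : ZMod (M + 3)) - 1) by
        push_cast; ring, Equiv.swap_apply_left] at this
      exact this

/-- Hamilton cycle, no `(n-1)`-cycle through `c 0`: the relations. -/
lemma relations {V C : Type*} [Fintype V] [Fintype C] {A : C → V → V → Prop} (hG : Good A) (M : ℕ)
    (hC : Fintype.card C = M + 3)
    (c : ZMod (M + 3) → V) (hc : Function.Injective c) (ψ : ZMod (M + 3) → C)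
    (hsur : Function.Surjective c) (hno : ∀ S, c 0 ∈ S → ¬ RC A (M + 2) S)
    (hψ : Function.Injective ψ) (hA : ∀ i, A (ψ i) (c i) (c (i + 1))) :
    (∀ f i, A f (c i) (c (i + 1))) ∧ ∀ f g, f ≠ g → ∀ i, i ≠ 0 →
    ¬ A f (c (i - 1)) (c (i + 1)) ∧
    ∀ k : ℕ, k < M + 1 → (A f (c (i + 1)) (c (i + 2 + k)) ↔
      ¬ A g (c (i - 1)) (c (i + 1 + k))) := by
  classical
  have hbij : Function.Bijective ψ :=
    (Fintype.bijective_iff_injective_and_card ψ).mpr ⟨hψ, by rw [hC, ZMod.card]⟩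
  have hall : ∀ f i, A f (c i) (c (i + 1)) := by
    intro f i
    obtain ⟨j, rfl⟩ := hbij.2 f
    have hi := ZMod.val_lt i
    have hj := ZMod.val_lt j
    have ei := ZMod.natCast_zmod_val i
    have ej := ZMod.natCast_zmod_val j
    rcases Nat.le_total j.val i.val with h | h
    · have := (all_colours hG M c hc hsur hno (i.val - j.val) ψ hψ hA j.val (by omega)).1
      rwa [show j.val + (i.val - j.val) = i.val by omega, ei, ej] at this
    · have := (all_colours hG M c hc hsur hno (j.val - i.val) ψ hψ hA i.val (by omega)).2
      rwa [show i.val + (j.val - i.val) = j.val by omega, ei, ej] at this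
  refine ⟨hall, ?_⟩
  intro f g hfg i hi
  have h11 : i ≠ i - 1 := by
    intro h
    have h1 : (1 : ZMod (M + 3)) = 0 := by linear_combination h
    have := natCast_ne_zero_of (M := M + 3) (t := 1) (by omega) (by omega)
    rw [Nat.cast_one] at this
    exact this h1
  obtain ⟨χ, hχ, h1, h2⟩ : ∃ χ : ZMod (M + 3) → C, Function.Injective χ ∧ χ (i - 1) = f ∧
      χ i = g := by
    refine ⟨fun j => Equiv.swap (Equiv.swap (ψ (i - 1)) f (ψ i)) g
      (Equiv.swap (ψ (i - 1)) f (ψ j)), ?_, ?_, ?_⟩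
    · exact (Equiv.injective _).comp ((Equiv.injective _).comp hψ)
    · simp only [Equiv.swap_apply_left]
      apply Equiv.swap_apply_of_ne_of_ne _ hfg
      intro h
      have h3 : Equiv.swap (ψ (i - 1)) f (ψ (i - 1)) = Equiv.swap (ψ (i - 1)) f (ψ i) := by
        rw [Equiv.swap_apply_left]; exact h
      exact h11 (hψ ((Equiv.injective _) h3)).symm
    · simp only [Equiv.swap_apply_left]
  have := step hG M c χ hc hsur hχ (fun j => hall _ j) hno i hi
  rw [h1, h2] at this
  exact this.2

/-- Part 2. -/
lemma part2 {V C : Type*} [Fintype V] [Fintype C] {A : C → V → V → Prop} (hG : Good A) (M : ℕ)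
    (hM : 2 ≤ M) (hV : Fintype.card V = M + 3) (hC : Fintype.card C = M + 3)
    (hham : RC A (M + 3) Set.univ) (x : V) (hno : ∀ S, x ∈ S → ¬ RC A (M + 2) S) :
    Even (M + 3) ∧ ∃ S : Finset V, 2 * S.card = M + 3 ∧ ∀ f u v, A f u v ↔
      ((u ∈ S ∧ v ∉ S) ∨ (u ∉ S ∧ v ∈ S)) := by
  classical
  obtain ⟨c0, ψ0, hc0, hψ0, hA0, hr0⟩ := hham
  obtain ⟨i0, hi0⟩ : ∃ i0, c0 i0 = x := by
    have : x ∈ Set.range c0 := by rw [hr0]; trivial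
    exact this
  obtain ⟨c, hcdef⟩ : ∃ c : ZMod (M + 3) → V, ∀ i, c i = c0 (i0 + i) := ⟨_, fun _ => rfl⟩
  have hc : Function.Injective c := by
    intro i j h
    rw [hcdef, hcdef] at h
    exact add_left_cancel (hc0 h)
  have hsur : Function.Surjective c :=
    ((Fintype.bijective_iff_injective_and_card c).mpr ⟨hc, by rw [hV, ZMod.card]⟩).2
  have hx : c 0 = x := by rw [hcdef, add_zero, hi0]
  obtain ⟨hE, hR⟩ := relations hG M hC c hc (fun i => ψ0 (i0 + i)) hsur (by rw [hx]; exact hno)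
    (fun i j h => add_left_cancel (hψ0 h)) (by
      intro i
      rw [hcdef, hcdef, ← add_assoc]
      exact hA0 _)
  have hper : ((M + 3 : ℕ) : ZMod (M + 3)) = 0 := ZMod.natCast_self _
  have hother : ∀ f : C, ∃ g, f ≠ g := by
    intro f
    have : Nontrivial C := Fintype.one_lt_card_iff_nontrivial.mp (by omega)
    obtain ⟨g, hg⟩ := exists_ne f
    exact ⟨g, hg.symm⟩
  have hE' : ∀ f (a : ℕ), A f (c (a : ℕ)) (c (a + 1 : ℕ)) := by
    intro f a; push_cast; exact hE f a
  have hN2 : ∀ f (a : ℕ), a + 1 < M + 3 → ¬ A f (c (a : ℕ)) (c (a + 2 : ℕ)) := by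
    intro f a ha
    obtain ⟨g, hg⟩ := hother f
    have := (hR f g hg ((a + 1 : ℕ)) (natCast_ne_zero_of (by omega) ha)).1
    rwa [show (((a + 1 : ℕ) : ZMod (M + 3)) - 1) = (a : ℕ) by push_cast; ring,
      show (((a + 1 : ℕ) : ZMod (M + 3)) + 1) = (a + 2 : ℕ) by push_cast; ring] at this
  have hR' : ∀ f g (a b : ℕ), f ≠ g → a + 1 < M + 3 → a + 3 ≤ b + 1 → b ≤ a + M + 2 →
      (A f (c (a + 2 : ℕ)) (c (b + 1 : ℕ)) ↔ ¬ A g (c (a : ℕ)) (c (b : ℕ))) := by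
    intro f g a b hfg ha hb1 hb2
    have := (hR f g hfg ((a + 1 : ℕ)) (natCast_ne_zero_of (by omega) ha)).2 (b - (a + 2)) (by omega)
    rwa [show (((a + 1 : ℕ) : ZMod (M + 3)) - 1) = (a : ℕ) by push_cast; ring,
      show (((a + 1 : ℕ) : ZMod (M + 3)) + 1) = (a + 2 : ℕ) by push_cast; ring,
      show (((a + 1 : ℕ) : ZMod (M + 3)) + 2 + ((b - (a + 2) : ℕ) : ZMod (M + 3))) = (b + 1 : ℕ) by
        rw [Nat.cast_sub (by omega)]; push_cast; ring,
      show ((a + 2 : ℕ) : ZMod (M + 3)) + ((b - (a + 2) : ℕ) : ZMod (M + 3)) = (b : ℕ) by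
        rw [Nat.cast_sub (by omega)]; push_cast; ring] at this
  have hU : ∀ f g (a b : ℕ), f ≠ g → a + 2 ≤ b → b ≤ M + 2 →
      (A f (c (a + 2 : ℕ)) (c (b + 1 : ℕ)) ↔ ¬ A g (c (a : ℕ)) (c (b : ℕ))) :=
    fun f g a b hfg h1 h2 => hR' f g a b hfg (by omega) (by omega) (by omega)
  have hD : ∀ f g (a b : ℕ), f ≠ g → b < a → a ≤ M + 1 →
      (A f (c (b + 1 : ℕ)) (c (a + 2 : ℕ)) ↔ ¬ A g (c (b : ℕ)) (c (a : ℕ))) := by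
    intro f g a b hfg h1 h2
    have h := hR' f g a (b + (M + 3)) hfg (by omega) (by omega) (by omega)
    rw [show ((b + (M + 3) + 1 : ℕ) : ZMod (M + 3)) = (b + 1 : ℕ) by
        rw [show b + (M + 3) + 1 = b + 1 + (M + 3) by omega, Nat.cast_add, hper, add_zero],
      show ((b + (M + 3) : ℕ) : ZMod (M + 3)) = (b : ℕ) by rw [Nat.cast_add, hper, add_zero]] at h
    exact ⟨fun h1 h2 => h.mp (hG.symm _ _ _ h1) (hG.symm _ _ _ h2),
      fun h1 => hG.symm _ _ _ (h.mpr fun h2 => h1 (hG.symm _ _ _ h2))⟩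
  have hpar : ∀ d : ℕ, ∀ f (b : ℕ), 1 ≤ d → b + d ≤ M + 2 → ¬ (b = 0 ∧ d = M + 2) →
      (A f (c (b : ℕ)) (c (b + d : ℕ)) ↔ Odd d) := by
    intro d
    induction d using Nat.strong_induction_on with
    | _ d ih =>
    intro f b hd hbd hex
    obtain ⟨g, hg⟩ := hother f
    rcases Nat.lt_or_ge d 3 with h3 | h3
    · obtain rfl | rfl : d = 1 ∨ d = 2 := by omega
      · exact ⟨fun _ => odd_one, fun _ => hE' f b⟩
      · exact ⟨fun h => absurd h (hN2 f b (by omega)), fun h => absurd h (by decide)⟩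
    · have hod : Odd d ↔ ¬ Odd (d - 1) := by
        obtain ⟨e, rfl⟩ : ∃ e, d = e + 1 := ⟨d - 1, by omega⟩
        rw [Nat.add_sub_cancel, Nat.odd_add_one]
      rcases Nat.eq_zero_or_pos b with rfl | hb
      · have h1 := hU g f 0 d hg.symm (by omega) (by omega)
        have h2 := ih (d - 1) (by omega) g 2 (by omega) (by omega) (by omega)
        rw [show 2 + (d - 1) = d + 1 by omega] at h2
        rw [zero_add] at h1 ⊢
        rw [hod, ← h2, h1, not_not]
      · obtain ⟨b, rfl⟩ : ∃ e, b = e + 1 := ⟨b - 1, by omega⟩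
        have h1 := hD f g (b + (d - 1)) b hg (by omega) (by omega)
        have h2 := ih (d - 1) (by omega) g b (by omega) (by omega) (by omega)
        rw [show b + (d - 1) + 2 = b + 1 + d by omega] at h1
        rw [h1, h2, hod]
  have hCne : Nonempty C := Fintype.card_pos_iff.mp (by omega)
  obtain ⟨f0⟩ := hCne
  have hev : Even (M + 3) := by
    obtain ⟨g, hg⟩ := hother f0
    have h1 := hR' f0 g 1 (M + 2) hg (by omega) (by omega) (by omega)
    have h2 := hpar 3 f0 0 (by omega) (by omega) (by omega)
    have h3 := hpar (M + 1) g 1 (by omega) (by omega) (by omega)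
    rw [show ((M + 2 + 1 : ℕ) : ZMod (M + 3)) = 0 from hper] at h1
    rw [show 1 + (M + 1) = M + 2 by omega] at h3
    rw [Nat.cast_zero, zero_add] at h2
    have h4 := hG.symm _ _ _ (h2.mpr (by decide))
    have h5 : ¬ Odd (M + 1) := fun h => h1.mp h4 (h3.mpr h)
    rw [Nat.not_odd_iff_even] at h5
    rw [show M + 3 = M + 1 + 2 by omega]
    exact h5.add even_two
  have hpar2 : ∀ f (a b : ℕ), a < b → b ≤ M + 2 →
      (A f (c (a : ℕ)) (c (b : ℕ)) ↔ Odd (b - a)) := by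
    intro f a b hab hb
    by_cases hex : a = 0 ∧ b = M + 2
    · obtain ⟨rfl, rfl⟩ := hex
      constructor
      · intro _
        rw [Nat.sub_zero]
        have := hev
        rw [show M + 3 = M + 2 + 1 by omega, Nat.even_add_one, Nat.not_even_iff_odd] at this
        exact this
      · intro _
        have := hE' f (M + 2)
        rw [show ((M + 2 + 1 : ℕ) : ZMod (M + 3)) = 0 from hper] at this
        rw [Nat.cast_zero]
        exact hG.symm _ _ _ this
    · have := hpar (b - a) f a (by omega) (by omega) (by omega)
      rwa [show a + (b - a) = b by omega] at this
  refine ⟨hev, ?_⟩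
  obtain ⟨m, hm⟩ := hev
  have hcinj : ∀ a b : ℕ, a < M + 3 → b < M + 3 → c (a : ℕ) = c (b : ℕ) → a = b := by
    intro a b ha hb h
    exact cast_inj_lt 0 ha hb (by rw [hc h])
  have hcov : ∀ v, ∃ a : ℕ, a < M + 3 ∧ v = c (a : ℕ) := by
    intro v
    obtain ⟨z, rfl⟩ := hsur v
    exact ⟨z.val, ZMod.val_lt z, by rw [ZMod.natCast_zmod_val]⟩
  refine ⟨(range m).image (fun t : ℕ => c ((2 * t : ℕ) : ZMod (M + 3))), ?_, ?_⟩
  · rw [card_image_of_injOn, card_range]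
    · omega
    · intro s hs t ht h
      simp only [coe_range, Set.mem_Iio] at hs ht
      have := hcinj (2 * s) (2 * t) (by omega) (by omega) h
      omega
  · have hmem : ∀ a : ℕ, a < M + 3 →
        (c (a : ℕ) ∈ (range m).image (fun t : ℕ => c ((2 * t : ℕ) : ZMod (M + 3))) ↔ Even a) := by
      intro a ha
      simp only [mem_image, mem_range]
      constructor
      · rintro ⟨t, ht, h⟩
        have := hcinj (2 * t) a (by omega) ha h
        rw [← this]
        exact even_two_mul t
      · rintro ⟨t, rfl⟩
        exact ⟨t, by omega, by rw [two_mul]⟩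
    intro f u v
    obtain ⟨a, ha, rfl⟩ := hcov u
    obtain ⟨b, hb, rfl⟩ := hcov v
    rw [hmem a ha, hmem b hb]
    rcases lt_trichotomy a b with h | h | h
    · rw [hpar2 f a b h (by omega), Nat.odd_sub h.le]
      simp only [← Nat.not_even_iff_odd]
      tauto
    · subst h
      constructor
      · intro h; exact absurd h (hG.irr _ _)
      · tauto
    · have : A f (c (a : ℕ)) (c (b : ℕ)) ↔ A f (c (b : ℕ)) (c (a : ℕ)) :=
        ⟨hG.symm _ _ _, hG.symm _ _ _⟩
      rw [this, hpar2 f b a h (by omega), Nat.odd_sub h.le]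
      simp only [← Nat.not_even_iff_odd]
      tauto

/-- The main result in terms of `RC`. -/
theorem main {V C : Type*} [Fintype V] [Fintype C] {A : C → V → V → Prop} (hG : Good A) (M : ℕ)
    (hM : 1 ≤ M) (hV : Fintype.card V = M + 2) (hC : Fintype.card C = M + 2)
    (hex : ¬ (Even (M + 2) ∧ ∃ S : Finset V, 2 * S.card = M + 2 ∧ ∀ f u v, A f u v ↔
      ((u ∈ S ∧ v ∉ S) ∨ (u ∉ S ∧ v ∈ S)))) (x : V) :
    ∀ e ℓ : ℕ, 4 ≤ ℓ → ℓ + e = M + 2 → ∃ S, RC A ℓ S ∧ x ∈ S := by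
  classical
  have hham : RC A (M + 2) Set.univ := ham M hM hV hC _ A hG rfl
  intro e
  induction e using Nat.strong_induction_on with
  | _ e ih =>
  intro ℓ h4 he
  rcases Nat.lt_or_ge e 2 with h | h
  · obtain rfl | rfl : e = 0 ∨ e = 1 := by omega
    · obtain rfl : ℓ = M + 2 := by omega
      exact ⟨_, hham, trivial⟩
    · obtain ⟨N, rfl⟩ : ∃ N, M = N + 1 := ⟨M - 1, by omega⟩
      obtain rfl : ℓ = N + 2 := by omega
      by_contra hno
      exact hex (part2 hG N (by omega) hV hC hham x (fun S hS hR => hno ⟨S, hR, hS⟩))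
  · obtain ⟨L, rfl⟩ : ∃ L, ℓ = L + 4 := ⟨ℓ - 4, by omega⟩
    exact reduce hG L x (ih (e - 2) (by omega) (L + 6) (by omega) (by omega))


end RB

theorem stmt0 {V : Type*} [Fintype V] {n : ℕ} (hn : 3 ≤ n)
    (hV : Fintype.card V = n)
    (G : ZMod n → SimpleGraph V) [∀ i, DecidableRel (G i).Adj]
    (hσ : ∀ u v : V, u ≠ v → (∃ i, ¬ (G i).Adj u v) →
      ∀ p q, n ≤ (G p).degree u + (G q).degree v) :
    (∀ x : V, ∀ ℓ : ℕ, 4 ≤ ℓ → ℓ ≤ n → HasRainbowCycleThrough G ℓ x) ∨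
    (Even n ∧ ∃ A : Finset V, 2 * A.card = n ∧
      ∀ (i : ZMod n) (u v : V), (G i).Adj u v ↔
        ((u ∈ A ∧ v ∉ A) ∨ (u ∉ A ∧ v ∈ A))) := by
  obtain ⟨M, rfl⟩ : ∃ M, n = M + 2 := ⟨n - 2, by omega⟩
  have hD : ∀ p u, RB.D (fun i u v => (G i).Adj u v) p u = (G p).degree u := by
    intro p u
    unfold RB.D
    rw [← SimpleGraph.card_neighborFinset_eq_degree]
    congr 1
    ext v
    simp
  have hG : RB.Good (fun i u v => (G i).Adj u v) :=
    { symm := fun i u v h => h.symm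
      irr := fun i u h => (G i).loopless.irrefl u h
      ore := by
        intro u v huv h p q
        rw [hD, hD, hV]
        exact hσ u v huv h p q }
  by_cases hex : Even (M + 2) ∧ ∃ A : Finset V, 2 * A.card = M + 2 ∧
      ∀ (i : ZMod (M + 2)) (u v : V), (G i).Adj u v ↔
        ((u ∈ A ∧ v ∉ A) ∨ (u ∉ A ∧ v ∈ A))
  · exact Or.inr hex
  · left
    intro x ℓ h4 hℓ
    obtain ⟨S, ⟨c, φ, hc, hφ, hA, hr⟩, hx⟩ :=
      RB.main hG M (by omega) hV (ZMod.card _) hex x (M + 2 - ℓ) ℓ h4 (by omega)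
    rw [← hr] at hx
    exact ⟨c, φ, ⟨hc, hφ, hA⟩, hx⟩
end

section
/- Let n ≥ 3 and let 𝒢 = {G_1, …, G_n} be a family of n graphs (not necessarily distinct) on a common vertex set V with |V| = n. If σ(𝒢) ≥ n, then either 𝒢 contains a rainbow cycle of length ℓ for every ℓ with 3 ≤ ℓ ≤ n, or n is even and G_1 = ⋯ = G_n = K_{n/2,n/2}. -/
namespace Rb

/-- `RW H u v l cs`: a walk from `u` to `v` with vertex list `l` and colour list `cs`. -/
inductive RW {V ι : Type*} (H : ι → SimpleGraph V) : V → V → List V → List ι → Prop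
  | nil (v : V) : RW H v v [v] []
  | cons {u v w : V} {l : List V} {cs : List ι} (c : ι) :
      (H c).Adj u v → RW H v w l cs → RW H u w (u :: l) (c :: cs)

theorem RW.append {V ι : Type*} {H : ι → SimpleGraph V} {u v v' w : V} {l₁ l₂ : List V}
    {c₁ c₂ : List ι} {c : ι} (h₁ : RW H u v l₁ c₁) (hc : (H c).Adj v v') (h₂ : RW H v' w l₂ c₂) :
    RW H u w (l₁ ++ l₂) (c₁ ++ c :: c₂) := by
  induction h₁ with
  | nil v => exact RW.cons c hc h₂
  | cons d hd _ ih => exact RW.cons d hd (ih hc)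

theorem RW.rev {V ι : Type*} {H : ι → SimpleGraph V} {u v : V} {l : List V}
    {cs : List ι} (h : RW H u v l cs) : RW H v u l.reverse cs.reverse := by
  induction h with
  | nil v => exact RW.nil v
  | cons d hd _ ih =>
    have := ih.append hd.symm (RW.nil _)
    simpa using this

theorem RW.seg {H : ℕ → SimpleGraph ℕ} (a m : ℕ)
    (h : ∀ j, a ≤ j → j < a + m → (H j).Adj j (j + 1)) :
    RW H a (a + m) (List.range' a (m + 1)) (List.range' a m) := by
  induction m generalizing a with
  | zero => exact RW.nil a
  | succ m ih =>
    have h2 := ih (a + 1) (fun j h1 h2 => h j (by omega) (by omega))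
    have := RW.cons a (h a le_rfl (by omega)) h2
    rw [show a + 1 + m = a + (m + 1) by ring] at this
    simpa [List.range'_succ] using this

theorem RW.seg' {H : ℕ → SimpleGraph ℕ} {a b : ℕ} (hab : a ≤ b)
    (h : ∀ j, a ≤ j → j < b → (H j).Adj j (j + 1)) :
    RW H a b (List.range' a (b - a + 1)) (List.range' a (b - a)) := by
  have := RW.seg (H := H) a (b - a) (fun j h1 h2 => h j h1 (by omega))
  rwa [show a + (b - a) = b by omega] at this

theorem RW.len {V ι : Type*} {H : ι → SimpleGraph V} {u v : V} {l : List V}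
    {cs : List ι} (h : RW H u v l cs) : l.length = cs.length + 1 := by
  induction h with
  | nil v => rfl
  | cons d hd _ ih => simp [ih]

theorem RW.zero {V ι : Type*} {H : ι → SimpleGraph V} {u v : V} {l : List V}
    {cs : List ι} (h : RW H u v l cs) : l[0]? = some u := by
  cases h <;> simp

theorem RW.last {V ι : Type*} {H : ι → SimpleGraph V} {u v : V} {l : List V}
    {cs : List ι} (h : RW H u v l cs) : l[cs.length]? = some v := by
  induction h with
  | nil v => rfl
  | cons d hd _ ih => simpa using ih

theorem RW.adj {V ι : Type*} {H : ι → SimpleGraph V} {u v : V} {l : List V}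
    {cs : List ι} (h : RW H u v l cs) (i : ℕ) (x y : V) (c : ι) (hx : l[i]? = some x)
    (hy : l[i + 1]? = some y) (hc : cs[i]? = some c) : (H c).Adj x y := by
  induction h generalizing i with
  | nil v => simp at hc
  | cons d hd hr ih =>
    cases i with
    | zero =>
      have := hr.zero
      simp at hx hy hc
      simp [hy] at this
      subst hx hc this
      exact hd
    | succ i => exact ih i (by simpa using hx) (by simpa using hy) (by simpa using hc)

/-- A rainbow cycle described by lists of naturals below `M`. -/
def Cyc (H : ℕ → SimpleGraph ℕ) (M ℓ : ℕ) : Prop :=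
  ∃ (u v : ℕ) (l cs : List ℕ) (c : ℕ), RW H u v l cs ∧ (H c).Adj v u ∧ l.Nodup ∧
    (c :: cs).Nodup ∧ (∀ x ∈ l, x < M) ∧ (∀ x ∈ c :: cs, x < M) ∧ l.length = ℓ

def pull {V ι : Type*} (G : ι → SimpleGraph V) (f : ℕ → V) (col : ℕ → ι) : ℕ → SimpleGraph ℕ :=
  fun c => (G (col c)).comap f

theorem close' {V ι : Type*} (G : ι → SimpleGraph V) {u v : V} {l : List V} {cs : List ι} {c : ι}
    {ℓ : ℕ} (h : RW G u v l cs) (hadj : (G c).Adj v u) (hl : l.Nodup) (hc : (c :: cs).Nodup)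
    (hlen : l.length = ℓ) :
    ∃ (c' : ZMod ℓ → V) (φ : ZMod ℓ → ι), IsRainbowCycle G c' φ ∧ ∀ i, c' i ∈ l := by
  obtain ⟨m, rfl⟩ : ∃ m, ℓ = m + 1 := ⟨cs.length, by rw [← hlen, h.len]⟩
  have hcl : cs.length = m := by have := h.len; omega
  have hcs : (cs ++ [c]).Nodup := by
    rw [List.nodup_append]; simp at hc ⊢; exact ⟨hc.2, fun a ha h => hc.1 (h ▸ ha)⟩
  have hcsl : (cs ++ [c]).length = m + 1 := by simp [hcl]
  have key : ∀ i j : Fin (m + 1), j = i + 1 → (G ((cs ++ [c])[i.1]'(by omega))).Adj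
      (l[i.1]'(by omega)) (l[j.1]'(by omega)) := by
    intro i j hj
    by_cases hi : i.1 = m
    · have hi1 : j.1 = 0 := by
        have : i = Fin.last m := Fin.ext hi
        subst this; simp [hj]
      have h0 := h.zero
      have h1 := h.last
      rw [List.getElem?_eq_getElem (by omega)] at h0 h1
      simp only [Option.some.injEq] at h0 h1
      simp only [hi1, hi, h0]
      rw [List.getElem_append_right (by omega)]
      simp only [hcl] at h1
      simp [hcl, h1, hadj]
    · have hi2 : i.1 < m := by omega
      have hi1 : j.1 = i.1 + 1 := by
        rw [hj, Fin.val_add_one_of_lt]; rw [Fin.lt_def]; simpa using hi2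
      simp only [hi1]
      rw [List.getElem_append_left (by omega)]
      exact h.adj i.1 _ _ _ (List.getElem?_eq_getElem _) (List.getElem?_eq_getElem _)
        (List.getElem?_eq_getElem _)
  refine ⟨fun i : Fin (m + 1) => l[i.1]'(by omega),
    fun i : Fin (m + 1) => (cs ++ [c])[i.1]'(by omega), ⟨?_, ?_, ?_⟩, ?_⟩
  · intro i j hij
    exact Fin.ext ((List.Nodup.getElem_inj_iff hl).1 hij)
  · intro i j hij
    exact Fin.ext ((List.Nodup.getElem_inj_iff hcs).1 hij)
  · intro i
    exact key i _ rfl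
  · intro i
    exact List.getElem_mem _

theorem RW.map {V ι : Type*} {G : ι → SimpleGraph V} {f : ℕ → V} {col : ℕ → ι} {u v : ℕ}
    {l cs : List ℕ} (h : RW (pull G f col) u v l cs) :
    RW G (f u) (f v) (l.map f) (cs.map col) := by
  induction h with
  | nil v => exact RW.nil _
  | cons d hd _ ih => exact RW.cons _ hd ih

theorem close {V ι : Type*} (G : ι → SimpleGraph V) (f : ℕ → V) (col : ℕ → ι) {M ℓ : ℕ}
    (hf : Set.InjOn f (Set.Iio M)) (hc : Set.InjOn col (Set.Iio M))
    (h : Cyc (pull G f col) M ℓ) :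
    ∃ (c' : ZMod ℓ → V) (φ : ZMod ℓ → ι), IsRainbowCycle G c' φ ∧ ∀ i, ∃ x < M, c' i = f x := by
  obtain ⟨u, v, l, cs, c, hw, ha, hl, hcs, h1, h2, h3⟩ := h
  obtain ⟨c', φ, hr, hm⟩ := close' G hw.map ha
    (List.Nodup.map_on (fun x hx y hy hxy => hf (h1 x hx) (h1 y hy) hxy) hl)
    (List.Nodup.map_on (f := col) (fun x hx y hy hxy => hc (h2 x hx) (h2 y hy) hxy) hcs)
    (ℓ := ℓ) (by simpa using h3)
  refine ⟨c', φ, hr, fun i => ?_⟩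
  obtain ⟨x, hx, hx2⟩ := List.mem_map.1 (hm i)
  exact ⟨x, h1 x hx, hx2.symm⟩

/-- crossing construction -/
theorem cross {H : ℕ → SimpleGraph ℕ} {M ℓ a b b' d x y : ℕ} {l₁ l₂ c₁ c₂ : List ℕ}
    (h₁ : RW H a b l₁ c₁) (h₂ : RW H b' d l₂ c₂) (hx : (H x).Adj b d) (hy : (H y).Adj b' a)
    (hl : (l₁ ++ l₂).Nodup) (hc : (x :: y :: (c₁ ++ c₂)).Nodup) (hM : ∀ z ∈ l₁ ++ l₂, z < M)
    (hcM : ∀ z ∈ x :: y :: (c₁ ++ c₂), z < M) (hlen : (l₁ ++ l₂).length = ℓ) : Cyc H M ℓ := by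
  refine ⟨a, b', l₁ ++ l₂.reverse, c₁ ++ x :: c₂.reverse, y, h₁.append hx h₂.rev, hy, ?_, ?_,
    ?_, ?_, ?_⟩
  · have : (l₁ ++ l₂.reverse).Perm (l₁ ++ l₂) := (List.reverse_perm l₂).append_left l₁
    exact this.nodup_iff.2 hl
  · have : (y :: (c₁ ++ x :: c₂.reverse)).Perm (x :: y :: (c₁ ++ c₂)) := by
      refine List.Perm.trans ?_ (List.Perm.swap _ _ _)
      refine List.Perm.cons _ ?_
      refine List.perm_middle.trans (List.Perm.cons _ ?_)
      exact (List.reverse_perm c₂).append_left c₁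
    exact this.nodup_iff.2 hc
  · intro z hz; apply hM; simpa using hz
  · intro z hz; apply hcM; simp at hz ⊢; tauto
  · simpa using hlen

end Rb

namespace Rb

section
open scoped Classical

/-- The number of `x` in the finset satisfying a predicate. -/
noncomputable def cnt {α : Type*} (s : Finset α) (P : α → Prop) : ℕ := (s.filter P).card

/-- indicator -/
noncomputable def ind (P : Prop) : ℕ := if P then 1 else 0

theorem ind_le (P : Prop) : ind P ≤ 1 := by unfold ind; split_ifs <;> omega
theorem ind_pos {P : Prop} (h : P) : ind P = 1 := by simp [ind, h]
theorem ind_neg {P : Prop} (h : ¬ P) : ind P = 0 := by simp [ind, h]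

theorem cnt_disj {α : Type*} (s : Finset α) (P Q : α → Prop)
    (h : ∀ x ∈ s, P x → Q x → False) : cnt s P + cnt s Q ≤ s.card := by
  unfold cnt
  rw [← Finset.card_union_of_disjoint]
  · apply Finset.card_le_card
    intro x hx
    simp at hx; tauto
  · rw [Finset.disjoint_left]
    intro x hx hy
    simp at hx hy
    exact h x hx.1 hx.2 hy.2

theorem cnt_erase {α : Type*} [DecidableEq α] (s : Finset α) (P : α → Prop) (a : α) :
    cnt s P ≤ cnt (s.erase a) P + ind (P a) := by
  unfold cnt ind
  split_ifs with h
  · rw [Finset.filter_erase]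
    have := Finset.pred_card_le_card_erase (s := s.filter P) (a := a)
    omega
  · apply Finset.card_le_card
    intro x hx
    simp at hx ⊢
    exact ⟨⟨fun e => h (e ▸ hx.2), hx.1⟩, hx.2⟩

theorem cnt_succ (n : ℕ) (P : ℕ → Prop) :
    cnt (Finset.range (n + 1)) P = cnt (Finset.range n) P + ind (P n) := by
  unfold cnt ind
  rw [Finset.range_add_one, Finset.filter_insert]
  split_ifs with h
  · rw [Finset.card_insert_of_notMem (by simp)]
  · rfl

theorem cnt_shift (n : ℕ) (P : ℕ → Prop) :
    cnt (Finset.range (n + 1)) P = cnt (Finset.range n) (fun j => P (j + 1)) + ind (P 0) := by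
  induction n with
  | zero => simp [cnt, ind, Finset.filter_singleton]; split_ifs <;> simp
  | succ n ih =>
    rw [cnt_succ, ih, cnt_succ (n := n)]; omega

theorem exists_both {α : Type*} (s : Finset α) (P Q : α → Prop) (h : s.card < cnt s P + cnt s Q) :
    ∃ x ∈ s, P x ∧ Q x := by
  by_contra hc
  push Not at hc
  have := cnt_disj s P Q (fun x hx hp hq => hc x hx hp hq)
  omega

section A2
variable {H : ℕ → SimpleGraph ℕ} {M : ℕ}

/-- If `y = M+1` can be inserted between `i` and `i+1` with colours `α, β`, we get crossing
constraints. -/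
theorem A2_cross (hseg : ∀ j < M, (H j).Adj j (j + 1))
    (hno : ¬ Cyc H (M + 2) (M + 2)) {i α β : ℕ} (hi : i < M) (hαβ : α ≠ β)
    (hα : M ≤ α ∧ α < M + 2) (hβ : M ≤ β ∧ β < M + 2)
    (h1 : (H α).Adj i (M + 1)) (h2 : (H β).Adj (M + 1) (i + 1)) :
    (∀ j < M, j ≠ i → ∀ x y, (x = i ∧ y = j ∨ x = j ∧ y = i) →
      (H x).Adj j M → (H y).Adj (j + 1) 0 → False) ∧
    ((H i).Adj i M → (H α).Adj (M + 1) 0 → False) ∧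
    ((H β).Adj (M + 1) M → (H i).Adj (i + 1) 0 → False) := by
  have hs : ∀ a b, a ≤ b → b ≤ M → RW H a b (List.range' a (b - a + 1)) (List.range' a (b - a)) :=
    fun a b hab hb => RW.seg' hab (fun j _ h2 => hseg j (by omega))
  refine ⟨?_, ?_, ?_⟩
  · intro j hj hji x y hxy hx hy
    apply hno
    rcases lt_or_gt_of_ne hji with h | h
    · refine cross (hs 0 j (by omega) (by omega))
        (((hs (j + 1) i (by omega) (by omega)).append h1 (RW.nil (M + 1))).append h2
          (hs (i + 1) M (by omega) (by omega))) hx hy ?_ ?_ ?_ ?_ ?_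
      · simp [List.nodup_append, List.nodup_range']; (repeat' (first | apply And.intro | intro _)) <;> omega
      · simp [List.nodup_append, List.nodup_range']; (repeat' (first | apply And.intro | intro _)) <;> omega
      · simp; (repeat' (first | apply And.intro | intro _)) <;> omega
      · simp; (repeat' (first | apply And.intro | intro _)) <;> omega
      · simp; omega
    · refine cross (((hs 0 i (by omega) (by omega)).append h1 (RW.nil (M + 1))).append h2
          (hs (i + 1) j (by omega) (by omega)))
        (hs (j + 1) M (by omega) (by omega)) hx hy ?_ ?_ ?_ ?_ ?_
      · simp [List.nodup_append, List.nodup_range']; (repeat' (first | apply And.intro | intro _)) <;> omega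
      · simp [List.nodup_append, List.nodup_range']; (repeat' (first | apply And.intro | intro _)) <;> omega
      · simp; (repeat' (first | apply And.intro | intro _)) <;> omega
      · simp; (repeat' (first | apply And.intro | intro _)) <;> omega
      · simp; omega
  · intro hx hy
    apply hno
    refine cross (hs 0 i (by omega) (by omega))
        ((RW.nil (M + 1)).append h2
          (hs (i + 1) M (by omega) (by omega))) hx hy ?_ ?_ ?_ ?_ ?_
    · simp [List.nodup_append, List.nodup_range']; (repeat' (first | apply And.intro | intro _)) <;> omega
    · simp [List.nodup_append, List.nodup_range']; (repeat' (first | apply And.intro | intro _)) <;> omega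
    · simp; (repeat' (first | apply And.intro | intro _)) <;> omega
    · simp; (repeat' (first | apply And.intro | intro _)) <;> omega
    · simp; omega
  · intro hx hy
    apply hno
    refine cross ((hs 0 i (by omega) (by omega)).append h1 (RW.nil (M + 1)))
          (hs (i + 1) M (by omega) (by omega)) hx hy ?_ ?_ ?_ ?_ ?_
    · simp [List.nodup_append, List.nodup_range']; (repeat' (first | apply And.intro | intro _)) <;> omega
    · simp [List.nodup_append, List.nodup_range']; (repeat' (first | apply And.intro | intro _)) <;> omega
    · simp; (repeat' (first | apply And.intro | intro _)) <;> omega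
    · simp; (repeat' (first | apply And.intro | intro _)) <;> omega
    · simp; omega

/-- closing up with `y` at the ends. -/
theorem A2_ends (hseg : ∀ j < M, (H j).Adj j (j + 1))
    (hno : ¬ Cyc H (M + 2) (M + 2)) {α β : ℕ} (hαβ : α ≠ β)
    (hα : M ≤ α ∧ α < M + 2) (hβ : M ≤ β ∧ β < M + 2)
    (h1 : (H α).Adj M (M + 1)) (h2 : (H β).Adj (M + 1) 0) : False := by
  apply hno
  refine ⟨_, _, _, _, β, (RW.seg' (Nat.zero_le M) (fun j _ h2 => hseg j (by omega))).append h1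
    (RW.nil (M + 1)), h2, ?_, ?_, ?_, ?_, ?_⟩
  · simp [List.nodup_append, List.nodup_range']; intro a ha; omega
  · simp [List.nodup_append, List.nodup_range']; (repeat' (first | apply And.intro | intro _)) <;> omega
  · simp; (repeat' (first | apply And.intro | intro _)) <;> omega
  · simp; (repeat' (first | apply And.intro | intro _)) <;> omega
  · simp

theorem A2_bound (hseg : ∀ j < M, (H j).Adj j (j + 1))
    (hno : ¬ Cyc H (M + 2) (M + 2)) {i α β : ℕ} (hi : i < M) (hαβ : α ≠ β)
    (hα : M ≤ α ∧ α < M + 2) (hβ : M ≤ β ∧ β < M + 2)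
    (h1 : (H α).Adj i (M + 1)) (h2 : (H β).Adj (M + 1) (i + 1))
    (hdeg : M + 2 ≤ cnt (Finset.range (M + 2)) (fun j => (H i).Adj 0 j) +
      cnt (Finset.range (M + 2)) (fun j => (H i).Adj M j)) :
    cnt (Finset.range M) (fun j => (H j).Adj j M) +
      cnt (Finset.range M) (fun j => (H j).Adj (j + 1) 0) ≤ M + 2 ∧
    ((H α).Adj (M + 1) 0 ∨ (H β).Adj (M + 1) M →
      cnt (Finset.range M) (fun j => (H j).Adj j M) +
      cnt (Finset.range M) (fun j => (H j).Adj (j + 1) 0) ≤ M) := by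
  obtain ⟨c1, c2, c3⟩ := A2_cross hseg hno hi hαβ hα hβ h1 h2
  have e1 := cnt_erase (Finset.range M) (fun j => (H j).Adj j M) i
  have e2 := cnt_erase (Finset.range M) (fun j => (H j).Adj (j + 1) 0) i
  have e3 := cnt_erase (Finset.range M) (fun j => (H i).Adj (j + 1) 0) i
  have e4 := cnt_erase (Finset.range M) (fun j => (H i).Adj j M) i
  have d1 := cnt_disj ((Finset.range M).erase i) (fun j => (H j).Adj j M)
    (fun j => (H i).Adj (j + 1) 0) (by
      intro j hj p q
      simp at hj
      exact c1 j hj.2 hj.1 j i (Or.inr ⟨rfl, rfl⟩) p q)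
  have d2 := cnt_disj ((Finset.range M).erase i) (fun j => (H i).Adj j M)
    (fun j => (H j).Adj (j + 1) 0) (by
      intro j hj p q
      simp at hj
      exact c1 j hj.2 hj.1 i j (Or.inl ⟨rfl, rfl⟩) p q)
  have hc : ((Finset.range M).erase i).card = M - 1 := by
    rw [Finset.card_erase_of_mem (by simpa using hi)]; simp
  rw [cnt_succ, cnt_shift, cnt_succ, cnt_succ] at hdeg
  simp only [SimpleGraph.adj_comm _ 0, SimpleGraph.adj_comm _ M] at hdeg
  have n0 : ind ((H i).Adj 0 0) = 0 := ind_neg (by simp)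
  have n1 : ind ((H i).Adj M M) = 0 := ind_neg (by simp)
  have l1 := ind_le ((H i).Adj (M + 1) M)
  have l2 := ind_le ((H i).Adj (M + 1) 0)
  have l3 := ind_le ((H i).Adj i M)
  have l4 := ind_le ((H i).Adj (i + 1) 0)
  rw [hc] at d1 d2
  refine ⟨by omega, ?_⟩
  rintro (h | h)
  · have := ind_neg (fun k => c2 k h)
    omega
  · have := ind_neg (fun k => c3 h k)
    omega

theorem A2_local (hseg : ∀ j < M, (H j).Adj j (j + 1))
    (hno : ¬ Cyc H (M + 2) (M + 2))
    (hdeg : ∀ i < M, M + 2 ≤ cnt (Finset.range (M + 2)) (fun j => (H i).Adj 0 j) +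
      cnt (Finset.range (M + 2)) (fun j => (H i).Adj M j))
    (hy : M + 2 ≤ cnt (Finset.range (M + 1)) (fun j => (H M).Adj (M + 1) j) +
      cnt (Finset.range (M + 1)) (fun j => (H (M + 1)).Adj (M + 1) j)) :
    cnt (Finset.range M) (fun j => (H j).Adj j M) +
      cnt (Finset.range M) (fun j => (H j).Adj (j + 1) 0) + ind ((H (M + 1)).Adj (M + 1) 0)
      + ind ((H M).Adj (M + 1) 0) + ind ((H M).Adj (M + 1) M) ≤ M + 2 := by
  have b1 : ind ((H (M + 1)).Adj (M + 1) 0) + ind ((H M).Adj (M + 1) M) ≤ 1 := by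
    by_contra hc
    have l1 := ind_le ((H (M + 1)).Adj (M + 1) 0)
    have l2 := ind_le ((H M).Adj (M + 1) M)
    have h1 : (H (M + 1)).Adj (M + 1) 0 := by
      by_contra h; have := ind_neg h; omega
    have h2 : (H M).Adj (M + 1) M := by
      by_contra h; have := ind_neg h; omega
    exact A2_ends hseg hno (α := M) (β := M + 1) (by omega) (by omega) (by omega) h2.symm h1
  have b2 : ind ((H M).Adj (M + 1) 0) + ind ((H (M + 1)).Adj (M + 1) M) ≤ 1 := by
    by_contra hc
    have l1 := ind_le ((H (M)).Adj (M + 1) 0)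
    have l2 := ind_le ((H (M + 1)).Adj (M + 1) M)
    have h1 : (H (M)).Adj (M + 1) 0 := by
      by_contra h; have := ind_neg h; omega
    have h2 : (H (M + 1)).Adj (M + 1) M := by
      by_contra h; have := ind_neg h; omega
    exact A2_ends hseg hno (α := M + 1) (β := M) (by omega) (by omega) (by omega) h2.symm h1
  have s1 := cnt_succ M (fun j => (H M).Adj (M + 1) j)
  have s2 := cnt_succ M (fun j => (H (M + 1)).Adj (M + 1) j)
  have s3 := cnt_shift M (fun j => (H M).Adj (M + 1) j)
  have s4 := cnt_shift M (fun j => (H (M + 1)).Adj (M + 1) j)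
  beta_reduce at s1 s2 s3 s4
  obtain ⟨i1, hi1, t1, t1'⟩ := exists_both (Finset.range M) (fun j => (H (M + 1)).Adj (M + 1) j)
    (fun j => (H M).Adj (M + 1) (j + 1)) (by simp; omega)
  obtain ⟨i2, hi2, t2, t2'⟩ := exists_both (Finset.range M) (fun j => (H M).Adj (M + 1) j)
    (fun j => (H (M + 1)).Adj (M + 1) (j + 1)) (by simp; omega)
  simp at hi1 hi2
  have B1 := A2_bound hseg hno (i := i1) (α := M + 1) (β := M) hi1 (by omega) (by omega) (by omega)
    t1.symm t1' (hdeg _ hi1)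
  have B2 := A2_bound hseg hno (i := i2) (α := M) (β := M + 1) hi2 (by omega) (by omega) (by omega)
    t2.symm t2' (hdeg _ hi2)
  have l1 := ind_le ((H (M + 1)).Adj (M + 1) 0)
  have l2 := ind_le ((H M).Adj (M + 1) 0)
  have l3 := ind_le ((H M).Adj (M + 1) M)
  by_cases h1 : (H (M + 1)).Adj (M + 1) 0
  · have := B1.2 (Or.inl h1); omega
  by_cases h2 : (H M).Adj (M + 1) 0
  · have := B2.2 (Or.inl h2); omega
  by_cases h3 : (H M).Adj (M + 1) M
  · have := B1.2 (Or.inr h3); omega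
  rw [ind_neg h1, ind_neg h2, ind_neg h3]
  omega

end A2
end
end Rb

namespace Rb

section
open scoped Classical

/-- degree of `v` in colour `p`. -/
noncomputable def dg {V ι : Type*} [Fintype V] (G : ι → SimpleGraph V) (p : ι) (v : V) : ℕ :=
  cnt Finset.univ (fun w => (G p).Adj v w)

/-- The Ore-type hypothesis. -/
def Sig {V ι : Type*} [Fintype V] (G : ι → SimpleGraph V) : Prop :=
  ∀ u v : V, u ≠ v → (∃ i, ¬ (G i).Adj u v) → ∀ p q, Fintype.card V ≤ dg G p u + dg G q v

theorem cnt_img {V : Type*} [Fintype V] {n : ℕ} (hn : Fintype.card V = n) (f : ℕ → V)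
    (hf : Set.InjOn f (Set.Iio n)) (P : V → Prop) :
    cnt (Finset.range n) (fun k => P (f k)) = cnt Finset.univ P := by
  have himg : (Finset.range n).image f = Finset.univ := by
    apply Finset.eq_univ_of_card
    rw [Finset.card_image_of_injOn (by simpa using hf)]; simp [hn]
  unfold cnt
  rw [← himg, Finset.filter_image, Finset.card_image_of_injOn]
  intro x hx y hy h
  simp at hx hy
  exact hf hx.1 hy.1 h

theorem zcast_inj {N a b : ℕ} (ha : a < N) (hb : b < N) (h : (a : ZMod N) = (b : ZMod N)) :
    a = b := by
  rw [ZMod.natCast_eq_natCast_iff] at h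
  exact Nat.ModEq.eq_of_lt_of_lt h ha hb

theorem cnt_lin {N : ℕ} [NeZero N] (r : ZMod N) (P : ZMod N → Prop) :
    cnt (Finset.range N) (fun k => P (r + (k : ℕ))) = cnt Finset.univ P := by
  refine cnt_img (ZMod.card N) (fun k => r + (k : ℕ)) ?_ P
  intro a ha b hb h
  exact zcast_inj ha hb (add_left_cancel h)

theorem cnt_eq_sum {α : Type*} (s : Finset α) (P : α → Prop) :
    cnt s P = ∑ x ∈ s, ind (P x) := by
  unfold cnt ind; rw [Finset.card_filter]

/-- linearization of a cycle starting at `r+1`, with an extra point `y` at the end. -/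
def lf {α : Type*} {M : ℕ} (c : ZMod (M + 1) → α) (y : α) (r : ZMod (M + 1)) (k : ℕ) : α :=
  if k ≤ M then c (r + 1 + (k : ℕ)) else y

theorem lf_inj {α : Type*} {M : ℕ} {c : ZMod (M + 1) → α} {y : α} (hc : Function.Injective c)
    (hy : ∀ i, c i ≠ y) (r : ZMod (M + 1)) : Set.InjOn (lf c y r) (Set.Iio (M + 2)) := by
  intro a ha b hb h
  simp only [Set.mem_Iio] at ha hb
  unfold lf at h
  split_ifs at h with h1 h2 h2
  · exact zcast_inj (by omega) (by omega) (add_left_cancel (hc h))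
  · exact absurd h (hy _)
  · exact absurd h.symm (hy _)
  · omega

theorem lf_le {α : Type*} {M : ℕ} (c : ZMod (M + 1) → α) (y : α) (r : ZMod (M + 1)) {k : ℕ}
    (h : k ≤ M) : lf c y r k = c (r + 1 + (k : ℕ)) := by simp [lf, h]

theorem zM (M : ℕ) (r : ZMod (M + 1)) : r + 1 + (M : ℕ) = r := by
  have : ((M + 1 : ℕ) : ZMod (M + 1)) = 0 := ZMod.natCast_self _
  push_cast at this
  linear_combination this

theorem lf_M {α : Type*} {M : ℕ} (c : ZMod (M + 1) → α) (y : α) (r : ZMod (M + 1)) :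
    lf c y r M = c r := by rw [lf_le _ _ _ le_rfl, zM]

theorem lf_0 {α : Type*} {M : ℕ} (c : ZMod (M + 1) → α) (y : α) (r : ZMod (M + 1)) :
    lf c y r 0 = c (r + 1) := by rw [lf_le _ _ _ (Nat.zero_le _)]; simp

theorem lf_y {α : Type*} {M : ℕ} (c : ZMod (M + 1) → α) (y : α) (r : ZMod (M + 1)) :
    lf c y r (M + 1) = y := by simp [lf]

/-- splitting a count over `V = range c ∪ {y}`. -/
theorem cnt_split {V : Type*} [Fintype V] {M : ℕ} (hn : Fintype.card V = M + 2)
    {c : ZMod (M + 1) → V} {y : V} (hc : Function.Injective c)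
    (hy : ∀ i, c i ≠ y) (P : V → Prop) :
    cnt Finset.univ P = cnt Finset.univ (fun x => P (c x)) + ind (P y) := by
  rw [← cnt_img hn (lf c y 0) (lf_inj hc hy 0) P, cnt_succ, lf_y,
    ← cnt_lin (0 + 1) (fun x => P (c x))]
  congr 1
  unfold cnt
  congr 1
  apply Finset.filter_congr
  intro k hk
  simp at hk
  rw [lf_le _ _ _ (by omega)]

theorem A2 {V ι : Type*} [Fintype V] [Fintype ι] {G : ι → SimpleGraph V} (hS : Sig G)
    {M : ℕ} (hn : Fintype.card V = M + 2) (hι : Fintype.card ι = M + 2) (hM : 1 ≤ M)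
    {c : ZMod (M + 1) → V} {φ : ZMod (M + 1) → ι} (hcyc : IsRainbowCycle G c φ)
    {y : V} (hy : ∀ i, c i ≠ y) (hyd : ∀ p, M + 2 ≤ 2 * dg G p y) :
    HasRainbowCycle G (M + 2) := by
  by_contra hno
  obtain ⟨hc, hφ, hadj⟩ := hcyc
  obtain ⟨s, hs⟩ : ∃ s, ∀ i, φ i ≠ s := by
    by_contra hcon
    push Not at hcon
    have := Fintype.card_le_of_surjective φ hcon
    rw [ZMod.card] at this; omega
  have hno' : ∀ (ψ : ZMod (M + 1) → ι) (_ : Function.Injective ψ) (_ : ∀ i, ψ i ≠ s) r,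
      ¬ Cyc (pull G (lf c y r) (lf ψ s r)) (M + 2) (M + 2) := by
    intro ψ hψ hψs r hC
    obtain ⟨c', φ', h, _⟩ := close G _ _ (lf_inj hc hy r) (lf_inj hψ hψs r) hC
    exact hno ⟨c', φ', h⟩
  have hsplit := fun P => cnt_split hn hc hy P
  have hydc : ∀ p, dg G p y = cnt Finset.univ (fun x => (G p).Adj y (c x)) := by
    intro p
    unfold dg
    rw [hsplit, ind_neg (by simp)]; rfl
  have hrr1 : ∀ r : ZMod (M + 1), r ≠ r + 1 := by
    intro r h
    have : (0 : ZMod (M + 1)) = 1 := by linear_combination h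
    have := zcast_inj (N := M + 1) (a := 0) (b := 1) (by omega) (by omega) (by simpa using this)
    omega
  have hpos : ∀ (x : ZMod (M + 1)) (k : ℕ), k < M → x + 1 + (k : ℕ) ≠ x := by
    intro x k hk h
    have h2 : x + 1 + (k : ℕ) = x + 1 + (M : ℕ) := by rw [h, zM]
    have := zcast_inj (N := M + 1) (by omega) (by omega) (add_left_cancel h2)
    omega
  have hnonsolid : ∀ r, ∃ i, ¬ (G i).Adj (c r) (c (r + 1)) := by
    intro r
    by_contra hcon
    push Not at hcon
    have e1 := cnt_lin (1 : ZMod (M + 1)) (fun x => (G (φ r)).Adj y (c x))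
    have e2 := cnt_lin (0 : ZMod (M + 1)) (fun x => (G (φ r)).Adj y (c (x + 1)))
    obtain ⟨x, -, hx1, hx2⟩ := exists_both Finset.univ (fun x => (G s).Adj y (c x))
      (fun x => (G (φ r)).Adj y (c (x + 1))) (by
        have h1 := hyd s
        have h2 := hyd (φ r)
        rw [hydc] at h1 h2
        rw [← e2]
        simp only [zero_add, add_comm _ (1 : ZMod (M + 1))]
        rw [e1]
        simp [ZMod.card]
        omega)
    refine A2_ends (α := M + 1) (β := M) ?_
      (hno' (φ ∘ Equiv.swap x r) (hφ.comp (Equiv.injective _)) (fun i => hs _) x)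
      (by omega) (by omega) (by omega) ?_ ?_
    · intro j hj
      simp only [pull, SimpleGraph.comap_adj]
      rw [lf_le _ _ _ (by omega), lf_le _ _ _ (by omega), lf_le _ _ _ (by omega)]
      have hne := hpos x j hj
      simp only [Function.comp]
      by_cases hr : x + 1 + (j : ℕ) = r
      · rw [hr, Equiv.swap_apply_right]
        push_cast
        rw [← add_assoc, hr]; exact hcon _
      · rw [Equiv.swap_apply_of_ne_of_ne hne hr]
        push_cast
        rw [← add_assoc]; exact hadj _
    · simp only [pull, SimpleGraph.comap_adj]
      rw [lf_y, lf_y, lf_M]; exact hx1.symm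
    · simp only [pull, SimpleGraph.comap_adj]
      rw [lf_y, lf_M, lf_0]; simpa using hx2
  have hdd : ∀ r p q, M + 2 ≤ dg G p (c r) + dg G q (c (r + 1)) := by
    intro r p q
    have := hS _ _ (fun h => hrr1 r (hc h)) (hnonsolid r) p q
    omega
  have hloc : ∀ r, cnt Finset.univ (fun x => (G (φ x)).Adj (c x) (c r)) +
      cnt Finset.univ (fun x => (G (φ x)).Adj (c (x + 1)) (c (r + 1))) +
      ind ((G s).Adj y (c (r + 1))) + ind ((G (φ r)).Adj y (c (r + 1)))
      + ind ((G (φ r)).Adj y (c r)) ≤ M + 2 := by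
    intro r
    have hfi := lf_inj hc hy r
    have key := A2_local (H := pull G (lf c y r) (lf φ s r)) (M := M) (by
      intro j hj
      simp only [pull, SimpleGraph.comap_adj]
      rw [lf_le _ _ _ (by omega), lf_le _ _ _ (by omega), lf_le _ _ _ (by omega)]
      push_cast
      rw [← add_assoc]; exact hadj _) (hno' φ hφ hs r) (by
      intro i hi
      simp only [pull, SimpleGraph.comap_adj, lf_M, lf_0]
      rw [cnt_img hn _ hfi (fun w => (G _).Adj (c (r + 1)) w),
        cnt_img hn _ hfi (fun w => (G _).Adj (c r) w)]
      have := hdd r (lf φ s r i) (lf φ s r i)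
      unfold dg at this
      omega) (by
      have h0 : ∀ p, dg G p y = cnt (Finset.range (M + 1)) (fun j => (G p).Adj y (lf c y r j)) := by
        intro p
        unfold dg
        rw [← cnt_img hn _ hfi (fun w => (G _).Adj y w), cnt_succ, lf_y, ind_neg (by simp)]; rfl
      simp only [pull, SimpleGraph.comap_adj, lf_M, lf_y]
      rw [← h0, ← h0]
      have := hyd (φ r)
      have := hyd s
      omega)
    simp only [pull, SimpleGraph.comap_adj, lf_M, lf_y, lf_0] at key
    have q1 : cnt Finset.univ (fun x => (G (φ x)).Adj (c x) (c r)) =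
        cnt (Finset.range M) (fun j => (G (lf φ s r j)).Adj (lf c y r j) (c r)) := by
      rw [← cnt_lin (r + 1), cnt_succ, zM, ind_neg (by simp)]
      unfold cnt
      rw [add_zero]
      congr 1
      apply Finset.filter_congr
      intro k hk
      simp at hk
      rw [lf_le _ _ _ (by omega), lf_le _ _ _ (by omega)]
    have q2 : cnt Finset.univ (fun x => (G (φ x)).Adj (c (x + 1)) (c (r + 1))) =
        cnt (Finset.range M) (fun j => (G (lf φ s r j)).Adj (lf c y r (j + 1)) (c (r + 1))) := by
      rw [← cnt_lin (r + 1), cnt_succ, zM, ind_neg (by simp)]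
      unfold cnt
      rw [add_zero]
      congr 1
      apply Finset.filter_congr
      intro k hk
      simp at hk
      rw [lf_le _ _ _ (by omega), lf_le _ _ _ (by omega)]
      push_cast
      rw [← add_assoc]
    rw [q1, q2]
    omega
  have hsum := Finset.sum_le_sum (fun r (_ : r ∈ (Finset.univ : Finset (ZMod (M + 1)))) => hloc r)
  simp only [Finset.sum_add_distrib] at hsum
  have r1 : ∑ r, cnt Finset.univ (fun x => (G (φ x)).Adj (c x) (c r)) +
      ∑ r, ind ((G (φ r)).Adj y (c r)) = ∑ x, dg G (φ x) (c x) := by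
    simp only [cnt_eq_sum]
    rw [Finset.sum_comm, ← Finset.sum_add_distrib]
    apply Finset.sum_congr rfl
    intro x _
    unfold dg
    rw [hsplit, cnt_eq_sum, SimpleGraph.adj_comm _ y]
  have r2 : ∑ r, cnt Finset.univ (fun x => (G (φ x)).Adj (c (x + 1)) (c (r + 1))) +
      ∑ r, ind ((G (φ r)).Adj y (c (r + 1))) = ∑ x, dg G (φ x) (c (x + 1)) := by
    simp only [cnt_eq_sum]
    rw [Finset.sum_comm, ← Finset.sum_add_distrib]
    apply Finset.sum_congr rfl
    intro x _
    unfold dg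
    rw [hsplit, cnt_eq_sum, SimpleGraph.adj_comm _ y]
    congr 1
    exact Equiv.sum_comp (Equiv.addRight (1 : ZMod (M + 1)))
      (fun r => ind ((G (φ x)).Adj (c (x + 1)) (c r)))
  have r3 : ∑ r, ind ((G s).Adj y (c (r + 1))) = dg G s y := by
    rw [hydc, cnt_eq_sum]
    exact Equiv.sum_comp (Equiv.addRight (1 : ZMod (M + 1)))
      (fun r => ind ((G s).Adj y (c r)))
  have hlow : ∑ _x : ZMod (M + 1), (M + 2) ≤ ∑ x, (dg G (φ x) (c x) + dg G (φ x) (c (x + 1))) :=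
    Finset.sum_le_sum (fun x _ => hdd x _ _)
  simp only [Finset.sum_add_distrib] at hlow
  have := hyd s
  omega

end
end Rb

namespace Rb

section
open scoped Classical

theorem A1 {V ι : Type*} [Fintype V] {G : ι → SimpleGraph V} (hS : Sig G)
    {M : ℕ} (hn : Fintype.card V = M + 2) (hM : 1 ≤ M)
    {f : ℕ → V} {col : ℕ → ι} (hf : Set.InjOn f (Set.Iio (M + 2)))
    (hcol : Set.InjOn col (Set.Iio (M + 2)))
    (hseg : ∀ j < M + 1, (G (col j)).Adj (f j) (f (j + 1)))
    (hna : ¬ (G (col (M + 1))).Adj (f 0) (f (M + 1))) :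
    ∃ (c : ZMod (M + 1) → V) (φ : ZMod (M + 1) → ι), IsRainbowCycle G c φ ∧
      ∀ i, c i ≠ f (M + 1) := by
  have hfi : Set.InjOn f (Set.Iio (M + 1)) := hf.mono (Set.Iio_subset_Iio (by omega))
  have hci : Set.InjOn col (Set.Iio (M + 1)) := hcol.mono (Set.Iio_subset_Iio (by omega))
  have hfin : ∀ col' : ℕ → ι, Set.InjOn col' (Set.Iio (M + 1)) →
      Cyc (pull G f col') (M + 1) (M + 1) → ∃ (c : ZMod (M + 1) → V) (φ : ZMod (M + 1) → ι),
        IsRainbowCycle G c φ ∧ ∀ i, c i ≠ f (M + 1) := by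
    intro col' hc' hC
    obtain ⟨c, φ, h, h2⟩ := close G f col' hfi hc' hC
    refine ⟨c, φ, h, fun i hi => ?_⟩
    obtain ⟨x, hx, hx2⟩ := h2 i
    have := hf (show x ∈ Set.Iio (M + 2) by simp; omega)
      (show M + 1 ∈ Set.Iio (M + 2) by simp) (hx2.symm.trans hi)
    omega
  have hs : ∀ (H : ℕ → SimpleGraph ℕ) a b, a ≤ b → (∀ j, a ≤ j → j < b → (H j).Adj j (j + 1)) →
     RW H a b (List.range' a (b - a + 1)) (List.range' a (b - a)) :=
    fun H a b hab hb => RW.seg' hab hb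
  by_cases hsol : ∀ i, (G i).Adj (f 0) (f M)
  · apply hfin col hci
    refine ⟨0, M, _, _, M, hs _ 0 M (by omega) (fun j _ h => hseg j (by omega)), (hsol _).symm,
      List.nodup_range', ?_, ?_, ?_, ?_⟩
    · simp [List.nodup_range']
    · simp
    · simp; omega
    · simp
  push Not at hsol
  have hd := hS (f 0) (f M) (fun h => by
    have := hfi (show 0 ∈ Set.Iio (M + 1) by simp) (show M ∈ Set.Iio (M + 1) by simp) h
    omega) hsol (col (M + 1)) (col M)
  unfold dg at hd
  rw [← cnt_img hn f hf, ← cnt_img hn f hf, cnt_succ, cnt_shift, cnt_succ, cnt_succ] at hd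
  rw [ind_neg hna, ind_neg (by simp), ind_neg (P := (G (col M)).Adj (f M) (f M)) (by simp)] at hd
  have l1 := ind_le ((G (col M)).Adj (f M) (f (M + 1)))
  obtain ⟨j, hj, h1, h2⟩ := exists_both (Finset.range M)
    (fun j => (G (col (M + 1))).Adj (f 0) (f (j + 1))) (fun j => (G (col M)).Adj (f M) (f j))
    (by rw [Finset.card_range]; omega)
  simp only [Finset.mem_range] at hj
  set col' : ℕ → ι := fun k => if k = j then col (M + 1) else col k with hcol'
  have hcj : ∀ k, k ≠ j → col' k = col k := fun k hk => by simp [hcol', hk]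
  have hcjj : col' j = col (M + 1) := by simp [hcol']
  apply hfin col'
  · intro a ha b hb hab
    simp only [Set.mem_Iio] at ha hb
    by_cases h1 : a = j <;> by_cases h2 : b = j
    · omega
    · rw [h1, hcjj, hcj _ h2] at hab
      have := hcol (show M + 1 ∈ Set.Iio (M + 2) by simp)
        (show b ∈ Set.Iio (M + 2) by simp; omega) hab
      omega
    · rw [h2, hcjj, hcj _ h1] at hab
      have := hcol (show a ∈ Set.Iio (M + 2) by simp; omega)
        (show M + 1 ∈ Set.Iio (M + 2) by simp) hab
      omega
    · rw [hcj _ h1, hcj _ h2] at hab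
      exact hci ha hb hab
  · have hseg' : ∀ k, k ≠ j → k < M → (pull G f col' k).Adj k (k + 1) := by
      intro k hk hkM
      simp only [pull, SimpleGraph.comap_adj]
      rw [hcj _ hk]; exact hseg k (by omega)
    refine cross (x := M) (y := j)
      (hs _ 0 j (by omega) (fun k _ h => hseg' k (by omega) (by omega)))
      (hs _ (j + 1) M (by omega) (fun k _ h => hseg' k (by omega) (by omega))) ?_ ?_ ?_ ?_ ?_ ?_ ?_
    · simp only [pull, SimpleGraph.comap_adj]
      rw [hcj _ (by omega)]; exact h2.symm
    · simp only [pull, SimpleGraph.comap_adj]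
      rw [hcjj]; exact h1.symm
    · simp [List.nodup_append, List.nodup_range']; (repeat' (first | apply And.intro | intro _)) <;> omega
    · simp [List.nodup_append, List.nodup_range']; (repeat' (first | apply And.intro | intro _)) <;> omega
    · simp; (repeat' (first | apply And.intro | intro _)) <;> omega
    · simp; (repeat' (first | apply And.intro | intro _)) <;> omega
    · simp; omega

theorem A_path {V ι : Type*} [Fintype V] [Fintype ι] {G : ι → SimpleGraph V} (hS : Sig G)
    {M : ℕ} (hn : Fintype.card V = M + 2) (hι : Fintype.card ι = M + 2) (hM : 1 ≤ M)
    {f : ℕ → V} {col : ℕ → ι} (hf : Set.InjOn f (Set.Iio (M + 2)))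
    (hcol : Set.InjOn col (Set.Iio (M + 2)))
    (hseg : ∀ j < M + 1, (G (col j)).Adj (f j) (f (j + 1)))
    (hna : ¬ (G (col (M + 1))).Adj (f 0) (f (M + 1))) :
    HasRainbowCycle G (M + 2) := by
  have hd := hS (f 0) (f (M + 1)) (fun h => by
    have := hf (show 0 ∈ Set.Iio (M + 2) by simp) (show M + 1 ∈ Set.Iio (M + 2) by simp) h
    omega) ⟨_, hna⟩
  by_cases hy : ∀ p, M + 2 ≤ 2 * dg G p (f (M + 1))
  · obtain ⟨c, φ, h, h2⟩ := A1 hS hn hM hf hcol hseg hna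
    exact A2 hS hn hι hM h h2 hy
  · push Not at hy
    obtain ⟨p, hp⟩ := hy
    have h0 : ∀ q, M + 2 ≤ 2 * dg G q (f 0) := by
      intro q; have := hd q p; omega
    have hx : ∀ k, k < M + 1 → (if k ≤ M then M - k else M + 1) = M - k := by
      intro k hk; rw [if_pos (by omega)]
    obtain ⟨c, φ, h, h2⟩ := A1 (f := fun k => f (M + 1 - k))
      (col := fun k => col (if k ≤ M then M - k else M + 1)) hS hn hM (by
        intro a ha b hb hab
        simp only [Set.mem_Iio] at ha hb
        have := hf (by simp; omega) (by simp; omega) hab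
        omega) (by
        intro a ha b hb hab
        simp only [Set.mem_Iio] at ha hb
        have := hcol (by simp; split_ifs <;> omega) (by simp; split_ifs <;> omega) hab
        split_ifs at this <;> omega) (by
        intro j hj
        beta_reduce
        rw [hx j hj]
        have := (hseg (M - j) (by omega)).symm
        rw [show M - j + 1 = M + 1 - j by omega] at this
        rwa [show M + 1 - (j + 1) = M - j by omega])
        (by
          rw [if_neg (by omega)]
          intro h; apply hna; simpa using h.symm)
    simp only [Nat.sub_self] at h2
    exact A2 hS hn hι hM h h2 h0

theorem cnt_mono {α : Type*} (s : Finset α) {P Q : α → Prop} (h : ∀ x, P x → Q x) :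
    cnt s P ≤ cnt s Q := by
  unfold cnt
  apply Finset.card_le_card
  intro x hx
  simp at hx ⊢
  exact ⟨hx.1, h _ hx.2⟩

theorem partA {V ι : Type*} [Fintype V] [Fintype ι] {M : ℕ} (hn : Fintype.card V = M + 2)
    (hι : Fintype.card ι = M + 2) (hM : 1 ≤ M) (G : ι → SimpleGraph V) :
    Sig G → HasRainbowCycle G (M + 2) := by
  induction G using WellFoundedGT.induction with
  | ind G ih =>
    intro hS
    by_cases hall : ∀ i u v, u ≠ v → (G i).Adj u v
    · have e1 : ZMod (M + 2) ≃ V := Fintype.equivOfCardEq (by rw [ZMod.card, hn])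
      have e2 : ZMod (M + 2) ≃ ι := Fintype.equivOfCardEq (by rw [ZMod.card, hι])
      refine ⟨e1, e2, e1.injective, e2.injective, fun i => hall _ _ _ (fun h => ?_)⟩
      have h2 := e1.injective h
      have : (0 : ZMod (M + 2)) = 1 := by linear_combination h2
      have := zcast_inj (N := M + 2) (a := 0) (b := 1) (by omega) (by omega) (by simpa using this)
      omega
    push Not at hall
    obtain ⟨e, u, v, huv, hna⟩ := hall
    set G' := Function.update G e (G e ⊔ SimpleGraph.edge u v) with hG'
    have hle : G ≤ G' := by
      intro i
      by_cases hi : i = e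
      · subst hi; simp [hG']
      · simp [hG', hi]
    have hlt : G < G' := by
      refine lt_of_le_of_ne hle (fun h => hna ?_)
      rw [h]
      simp [hG', SimpleGraph.edge_adj, huv]
    obtain ⟨c, φ, hc, hφ, hadj⟩ := ih G' hlt (by
      intro a b hab hex p q
      obtain ⟨i, hi⟩ := hex
      refine (hS a b hab ⟨i, fun h => hi (hle i h)⟩ p q).trans ?_
      exact add_le_add (cnt_mono _ (fun w h => hle p h)) (cnt_mono _ (fun w h => hle q h)))
    have hsur : Function.Surjective φ :=
      ((Fintype.bijective_iff_injective_and_card φ).2 ⟨hφ, by rw [ZMod.card, hι]⟩).2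
    obtain ⟨r, hr⟩ := hsur e
    have hne : ∀ i, i ≠ r → (G (φ i)).Adj (c i) (c (i + 1)) := by
      intro i hi
      have : φ i ≠ e := fun h => hi (hφ (h.trans hr.symm))
      have h2 := hadj i
      rw [hG', Function.update_of_ne this] at h2
      exact h2
    by_cases hgood : (G e).Adj (c r) (c (r + 1))
    · refine ⟨c, φ, hc, hφ, fun i => ?_⟩
      by_cases hi : i = r
      · subst hi; rw [hr]; exact hgood
      · exact hne i hi
    · have hz : r + 1 + ((M + 1 : ℕ) : ZMod (M + 2)) = r := zM (M + 1) r
      refine A_path (f := fun k => c (r + 1 + (k : ℕ))) (col := fun k => φ (r + 1 + (k : ℕ)))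
        hS hn hι hM ?_ ?_ ?_ ?_
      · intro a ha b hb h
        exact zcast_inj ha hb (add_left_cancel (hc h))
      · intro a ha b hb h
        exact zcast_inj ha hb (add_left_cancel (hφ h))
      · intro j hj
        have := hne (r + 1 + (j : ℕ)) (by
          intro h
          have := zcast_inj (by omega) (by omega) (add_left_cancel (h.trans hz.symm))
          omega)
        push_cast
        rw [← add_assoc]; exact this
      · beta_reduce
        rw [hz, hr]
        intro h
        apply hgood
        simpa using h.symm

end
end Rb

namespace Rb

section
open scoped Classical

theorem B_noboth {H : ℕ → SimpleGraph ℕ} {s L : ℕ} (hL : L + 2 ≤ s)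
    (hseg : ∀ j < s + 1, (H j).Adj j (j + 1)) (hcl : (H (s + 1)).Adj (s + 1) 0)
    (hno : ¬ Cyc H (s + 2) (L + 3)) {i : ℕ} (hi : i < s) (h1 : (H i).Adj 0 (i + 1))
    (h2 : (H ((i + L) % s + 1)).Adj (s + 1) ((i + L) % s + 1)) : False := by
  apply hno
  have hs : ∀ a b, a ≤ b → b ≤ s + 1 →
      RW H a b (List.range' a (b - a + 1)) (List.range' a (b - a)) :=
    fun a b hab hb => RW.seg' hab (fun j _ h2 => hseg j (by omega))
  by_cases h : i + L < s
  · rw [Nat.mod_eq_of_lt h] at h2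
    refine ⟨_, _, _, _, s + 1, ((RW.nil 0).append h1
      (hs (i + 1) (i + L + 1) (by omega) (by omega))).append h2.symm (RW.nil (s + 1)), hcl,
      ?_, ?_, ?_, ?_, ?_⟩
    · simp [List.nodup_append, List.nodup_range']; (repeat' (first | apply And.intro | intro _)) <;> omega
    · simp [List.nodup_append, List.nodup_range']; (repeat' (first | apply And.intro | intro _)) <;> omega
    · simp; (repeat' (first | apply And.intro | intro _)) <;> omega
    · simp; (repeat' (first | apply And.intro | intro _)) <;> omega
    · simp
  · have ht : (i + L) % s = i + L - s := by
      rw [Nat.mod_eq_sub_mod (by omega), Nat.mod_eq_of_lt (by omega)]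
    rw [ht] at h2
    refine cross (x := i + L - s + 1) (y := i) (hs 0 (i + L - s + 1) (by omega) (by omega))
      (hs (i + 1) (s + 1) (by omega) (by omega)) h2.symm h1.symm ?_ ?_ ?_ ?_ ?_
    · simp [List.nodup_append, List.nodup_range']; (repeat' (first | apply And.intro | intro _)) <;> omega
    · simp [List.nodup_append, List.nodup_range']; (repeat' (first | apply And.intro | intro _)) <;> omega
    · simp; (repeat' (first | apply And.intro | intro _)) <;> omega
    · simp; (repeat' (first | apply And.intro | intro _)) <;> omega
    · simp; omega

theorem B_chord {H : ℕ → SimpleGraph ℕ} {s L : ℕ} (hL : L + 2 ≤ s)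
    (hseg : ∀ j < s + 1, (H j).Adj j (j + 1))
    (hno : ¬ Cyc H (s + 2) (L + 3)) (h : (H (L + 2)).Adj (L + 2) 0) : False := by
  apply hno
  refine ⟨_, _, _, _, L + 2, RW.seg' (H := H) (a := 0) (b := L + 2) (by omega)
    (fun j _ h2 => hseg j (by omega)), h, ?_, ?_, ?_, ?_, ?_⟩
  · simp [List.nodup_range']
  · simp [List.nodup_range']
  · simp; omega
  · simp; (repeat' (first | apply And.intro | intro _)) <;> omega
  · simp

theorem cnt_reindex {s : ℕ} (g : ℕ → ℕ) (hg : ∀ i < s, g i < s)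
    (hinj : Set.InjOn g (Set.Iio s)) (Q : ℕ → Prop) :
    cnt (Finset.range s) (fun i => Q (g i)) = cnt (Finset.range s) Q := by
  have himg : (Finset.range s).image g = Finset.range s := by
    apply Finset.eq_of_subset_of_card_le
    · intro x hx
      simp at hx ⊢
      obtain ⟨a, ha, rfl⟩ := hx
      exact hg a ha
    · rw [Finset.card_image_of_injOn (by simpa using hinj)]
  unfold cnt
  conv_rhs => rw [← himg]
  rw [Finset.filter_image, Finset.card_image_of_injOn]
  intro x hx y hy h
  simp at hx hy
  exact hinj hx.1 hy.1 h

theorem cnt_match {s : ℕ} (P Q : ℕ → Prop) (g : ℕ → ℕ) (hg : ∀ i < s, g i < s)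
    (hinj : Set.InjOn g (Set.Iio s)) (h : ∀ i < s, P i → Q (g i) → False) :
    cnt (Finset.range s) P + cnt (Finset.range s) Q ≤ s ∧
    (cnt (Finset.range s) P + cnt (Finset.range s) Q = s → ∀ i < s, ¬ P i → Q (g i)) := by
  rw [← cnt_reindex g hg hinj Q]
  have h1 := cnt_disj (Finset.range s) P (fun i => Q (g i)) (by
    intro x hx; simp at hx; exact h x hx)
  rw [Finset.card_range] at h1
  refine ⟨h1, fun heq i hi hP => ?_⟩
  by_contra hQ
  have e1 := cnt_erase (Finset.range s) P i
  have e2 := cnt_erase (Finset.range s) (fun i => Q (g i)) i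
  beta_reduce at e2
  rw [ind_neg hP] at e1
  rw [ind_neg hQ] at e2
  have h2 := cnt_disj ((Finset.range s).erase i) P (fun i => Q (g i)) (by
    intro x hx; simp at hx; exact h x hx.2)
  rw [Finset.card_erase_of_mem (by simpa using hi), Finset.card_range] at h2
  omega

theorem shift_lt {s L : ℕ} (i : ℕ) (hi : i < s) : (i + L) % s < s := Nat.mod_lt _ (by omega)

theorem shift_inj {s L : ℕ} : Set.InjOn (fun i => (i + L) % s) (Set.Iio s) := by
  intro a ha b hb h
  have : a + L ≡ b + L [MOD s] := h
  exact Nat.ModEq.eq_of_lt_of_lt (Nat.ModEq.add_right_cancel' _ this) ha hb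

theorem B_local {H : ℕ → SimpleGraph ℕ} {s L : ℕ} (hL : L + 2 ≤ s)
    (hseg : ∀ j < s + 1, (H j).Adj j (j + 1)) (hcl : (H (s + 1)).Adj (s + 1) 0)
    (hno : ¬ Cyc H (s + 2) (L + 3)) (h0 h1 : Prop) (P Q : ℕ → Prop)
    (hP0 : ¬ P 0) (hP1 : P (s + 1) ↔ h1) (hQ0 : Q 0 ↔ h0) (hQ1 : ¬ Q (s + 1))
    (hP : ∀ i < s, P (i + 1) ↔ (H i).Adj 0 (i + 1))
    (hQ : ∀ i < s, Q (i + 1) ↔ (H (i + 1)).Adj (s + 1) (i + 1)) :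
    cnt (Finset.range (s + 2)) P + cnt (Finset.range (s + 2)) Q ≤ s + 2 ∧
    (cnt (Finset.range (s + 2)) P + cnt (Finset.range (s + 2)) Q = s + 2 →
      h0 ∧ h1 ∧ ∀ i < s, (P (i + 1) ↔ ¬ Q ((i + L) % s + 1))) := by
  have hnb : ∀ i < s, P (i + 1) → Q ((i + L) % s + 1) → False := by
    intro i hi p q
    rw [hP i hi] at p
    rw [hQ _ (shift_lt i hi)] at q
    exact B_noboth hL hseg hcl hno hi p q
  obtain ⟨m1, m2⟩ := cnt_match (fun i => P (i + 1)) (fun i => Q (i + 1)) (fun i => (i + L) % s)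
    shift_lt shift_inj hnb
  have c1 : cnt (Finset.range (s + 2)) P = cnt (Finset.range s) (fun i => P (i + 1)) + ind h1 := by
    rw [cnt_succ, cnt_shift, ind_neg hP0, show ind (P (s + 1)) = ind h1 by rw [propext hP1]]
    omega
  have c2 : cnt (Finset.range (s + 2)) Q = cnt (Finset.range s) (fun i => Q (i + 1)) + ind h0 := by
    rw [cnt_succ, cnt_shift, ind_neg hQ1, show ind (Q 0) = ind h0 by rw [propext hQ0]]
    omega
  have l1 := ind_le h1
  have l0 := ind_le h0
  rw [c1, c2]
  refine ⟨by omega, fun heq => ⟨?_, ?_, ?_⟩⟩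
  · by_contra h; have := ind_neg h; omega
  · by_contra h; have := ind_neg h; omega
  · intro i hi
    refine ⟨fun p q => hnb i hi p q, fun q => ?_⟩
    by_contra p
    exact q (m2 (by omega) i hi p)

end
end Rb

namespace Rb

section
open scoped Classical

theorem zlast (s : ℕ) (r : ZMod (s + 2)) : r + ((s + 1 : ℕ) : ZMod (s + 2)) = r - 1 := by
  have : ((s + 2 : ℕ) : ZMod (s + 2)) = 0 := ZMod.natCast_self _
  push_cast at this ⊢
  linear_combination this

theorem zlin_inj {α : Type*} {N : ℕ} {v : ZMod N → α} (hv : Function.Injective v) (r : ZMod N) :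
    Set.InjOn (fun k : ℕ => v (r + (k : ℕ))) (Set.Iio N) := by
  intro a ha b hb h
  exact zcast_inj ha hb (add_left_cancel (hv h))

theorem zadd_ne {N : ℕ} (r : ZMod N) {k : ℕ} (h0 : 0 < k) (hk : k < N) : r + (k : ℕ) ≠ r := by
  intro h
  have : (k : ZMod N) = ((0 : ℕ) : ZMod N) := by push_cast; linear_combination h
  have := zcast_inj hk (by omega) this
  omega

theorem B_nocyc {V ι : Type*} {G : ι → SimpleGraph V}
    {s ℓ : ℕ} {v : ZMod (s + 2) → V} {φ : ZMod (s + 2) → ι} (hcyc : IsRainbowCycle G v φ)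
    (hno : ¬ HasRainbowCycle G ℓ) (r : ZMod (s + 2)) :
    ¬ Cyc (pull G (fun k : ℕ => v (r + (k : ℕ))) (fun k : ℕ => φ (r + (k : ℕ)))) (s + 2) ℓ ∧
    (∀ j < s + 1, (pull G (fun k : ℕ => v (r + (k : ℕ))) (fun k : ℕ => φ (r + (k : ℕ))) j).Adj
      j (j + 1)) ∧
    (pull G (fun k : ℕ => v (r + (k : ℕ))) (fun k : ℕ => φ (r + (k : ℕ))) (s + 1)).Adj
      (s + 1) 0 := by
  refine ⟨fun hC => ?_, fun j hj => ?_, ?_⟩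
  · obtain ⟨c', φ', h, _⟩ := close G _ _ (zlin_inj hcyc.1 r) (zlin_inj hcyc.2.1 r) hC
    exact hno ⟨c', φ', h⟩
  · simp only [pull, SimpleGraph.comap_adj]
    push_cast
    rw [← add_assoc]; exact hcyc.2.2 _
  · simp only [pull, SimpleGraph.comap_adj]
    rw [zlast]
    simpa using hcyc.2.2 (r - 1)

theorem B_chord' {V ι : Type*} {G : ι → SimpleGraph V}
    {s L : ℕ} (hL : L + 2 ≤ s)
    {v : ZMod (s + 2) → V} {φ : ZMod (s + 2) → ι} (hcyc : IsRainbowCycle G v φ)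
    (hno : ¬ HasRainbowCycle G (L + 3)) (r : ZMod (s + 2)) :
    ¬ (G (φ (r + ((L + 2 : ℕ) : ZMod (s + 2))))).Adj (v (r + ((L + 2 : ℕ) : ZMod (s + 2)))) (v r) := by
  intro h
  obtain ⟨h1, h2, h3⟩ := B_nocyc hcyc hno r
  refine B_chord hL h2 h1 ?_
  simp only [pull, SimpleGraph.comap_adj]
  simpa using h

theorem dg_cyc {V ι : Type*} [Fintype V] {G : ι → SimpleGraph V}
    {N : ℕ} [NeZero N] (hn : Fintype.card V = N) {v : ZMod N → V} (hv : Function.Injective v)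
    (p : ι) (u : V) : dg G p u = cnt Finset.univ (fun x => (G p).Adj u (v x)) := by
  unfold dg
  rw [← cnt_img hn (fun k : ℕ => v (0 + (k : ℕ))) (zlin_inj hv 0), ← cnt_lin 0]

theorem B_eq {V ι : Type*} [Fintype V] {G : ι → SimpleGraph V} (hS : Sig G)
    {s L : ℕ} (hn : Fintype.card V = s + 2) (hL : L + 2 ≤ s)
    {v : ZMod (s + 2) → V} {φ : ZMod (s + 2) → ι} (hcyc : IsRainbowCycle G v φ)
    (hno : ¬ HasRainbowCycle G (L + 3)) (r : ZMod (s + 2)) :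
    cnt Finset.univ (fun x => (G (φ (x - 1))).Adj (v r) (v x)) +
      cnt Finset.univ (fun x => (G (φ x)).Adj (v (r - 1)) (v x)) = s + 2 ∧
    (G (φ r)).Adj (v (r - 1)) (v r) ∧ (G (φ (r - 1 - 1))).Adj (v r) (v (r - 1)) ∧
    ∀ i < s, ((G (φ (r + (i : ℕ)))).Adj (v r) (v (r + ((i + 1 : ℕ) : ZMod (s + 2)))) ↔
      ¬ (G (φ (r + (((i + L) % s + 1 : ℕ) : ZMod (s + 2))))).Adj (v (r - 1))
        (v (r + (((i + L) % s + 1 : ℕ) : ZMod (s + 2))))) := by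
  have hloc : ∀ r, cnt Finset.univ (fun x => (G (φ (x - 1))).Adj (v r) (v x)) +
      cnt Finset.univ (fun x => (G (φ x)).Adj (v (r - 1)) (v x)) ≤ s + 2 ∧ (
      cnt Finset.univ (fun x => (G (φ (x - 1))).Adj (v r) (v x)) +
      cnt Finset.univ (fun x => (G (φ x)).Adj (v (r - 1)) (v x)) = s + 2 →
    (G (φ r)).Adj (v (r - 1)) (v r) ∧ (G (φ (r - 1 - 1))).Adj (v r) (v (r - 1)) ∧
    ∀ i < s, ((G (φ (r + (i : ℕ)))).Adj (v r) (v (r + ((i + 1 : ℕ) : ZMod (s + 2)))) ↔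
      ¬ (G (φ (r + (((i + L) % s + 1 : ℕ) : ZMod (s + 2))))).Adj (v (r - 1))
        (v (r + (((i + L) % s + 1 : ℕ) : ZMod (s + 2)))))) := by
    intro r
    obtain ⟨h1, h2, h3⟩ := B_nocyc hcyc hno r
    have e : ∀ i : ℕ, r + ((i + 1 : ℕ) : ZMod (s + 2)) - 1 = r + (i : ℕ) := by
      intro i; push_cast; ring
    have key := B_local hL h2 h3 h1 ((G (φ r)).Adj (v (r - 1)) (v r))
      ((G (φ (r - 1 - 1))).Adj (v r) (v (r - 1)))
      (fun k => (G (φ (r + (k : ℕ) - 1))).Adj (v r) (v (r + (k : ℕ))))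
      (fun k => (G (φ (r + (k : ℕ)))).Adj (v (r - 1)) (v (r + (k : ℕ))))
      (by simp) (by beta_reduce; rw [zlast]) (by simp) (by rw [zlast]; simp)
      (by
        intro i hi
        beta_reduce
        simp only [pull, SimpleGraph.comap_adj]
        rw [e]; simp)
      (by
        intro i hi
        simp only [pull, SimpleGraph.comap_adj]
        rw [zlast])
    beta_reduce at key
    rw [cnt_lin r (fun x => (G (φ (x - 1))).Adj (v r) (v x)),
      cnt_lin r (fun x => (G (φ x)).Adj (v (r - 1)) (v x))] at key
    refine ⟨key.1, fun heq => ?_⟩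
    obtain ⟨k1, k2, k3⟩ := key.2 heq
    refine ⟨k1, k2, fun i hi => ?_⟩
    have := k3 i hi
    rw [e] at this
    exact this
  have hup := Finset.sum_le_sum
    (fun r (_ : r ∈ (Finset.univ : Finset (ZMod (s + 2)))) => (hloc r).1)
  have r1 : ∑ r, cnt Finset.univ (fun x => (G (φ (x - 1))).Adj (v r) (v x)) =
      ∑ x, dg G (φ (x - 1)) (v x) := by
    simp only [cnt_eq_sum, dg_cyc hn hcyc.1]
    rw [Finset.sum_comm]
    apply Finset.sum_congr rfl
    intro x _
    apply Finset.sum_congr rfl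
    intro y _
    rw [SimpleGraph.adj_comm]
  have r2 : ∑ r, cnt Finset.univ (fun x => (G (φ x)).Adj (v (r - 1)) (v x)) =
      ∑ x, dg G (φ x) (v x) := by
    simp only [cnt_eq_sum, dg_cyc hn hcyc.1]
    rw [Finset.sum_comm]
    apply Finset.sum_congr rfl
    intro x _
    rw [← Equiv.sum_comp (Equiv.subRight (1 : ZMod (s + 2)))
      (fun y => ind ((G (φ x)).Adj (v x) (v y)))]
    apply Finset.sum_congr rfl
    intro y _
    rw [SimpleGraph.adj_comm]; rfl
  have r3 : ∑ x, dg G (φ x) (v x) = ∑ x, dg G (φ (x + ((L + 2 : ℕ) : ZMod (s + 2))))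
      (v (x + ((L + 2 : ℕ) : ZMod (s + 2)))) :=
    (Equiv.sum_comp (Equiv.addRight ((L + 2 : ℕ) : ZMod (s + 2)))
      (fun x => dg G (φ x) (v x))).symm
  have hlow : ∑ _x : ZMod (s + 2), (s + 2) ≤ ∑ x, (dg G (φ (x - 1)) (v x) +
      dg G (φ (x + ((L + 2 : ℕ) : ZMod (s + 2)))) (v (x + ((L + 2 : ℕ) : ZMod (s + 2))))) := by
    apply Finset.sum_le_sum
    intro x _
    refine hn.symm.le.trans ?_
    refine hS _ _ (fun h => ?_) ⟨_, fun h => B_chord' hL hcyc hno x h.symm⟩ _ _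
    exact zadd_ne x (k := L + 2) (by omega) (by omega) (hcyc.1 h).symm
  have heq : cnt Finset.univ (fun x => (G (φ (x - 1))).Adj (v r) (v x)) +
      cnt Finset.univ (fun x => (G (φ x)).Adj (v (r - 1)) (v x)) = s + 2 := by
    by_contra hne
    have hlt : ∑ r, (cnt Finset.univ (fun x => (G (φ (x - 1))).Adj (v r) (v x)) +
      cnt Finset.univ (fun x => (G (φ x)).Adj (v (r - 1)) (v x))) < ∑ _x : ZMod (s + 2), (s + 2) :=
      Finset.sum_lt_sum (fun r _ => (hloc r).1)
        ⟨r, Finset.mem_univ _, lt_of_le_of_ne (hloc r).1 hne⟩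
    rw [Finset.sum_add_distrib, r1, r2, r3, ← Finset.sum_add_distrib] at hlt
    omega
  exact ⟨heq, (hloc r).2 heq⟩

theorem B_solid {V ι : Type*} [Fintype V] {G : ι → SimpleGraph V} (hS : Sig G)
    {s L : ℕ} (hn : Fintype.card V = s + 2) (hL : L + 2 ≤ s)
    {v : ZMod (s + 2) → V} (hno : ¬ HasRainbowCycle G (L + 3)) (k : ℕ) :
    ∀ φ : ZMod (s + 2) → ι, IsRainbowCycle G v φ → ∀ x,
      (G (φ (x + (k : ℕ)))).Adj (v x) (v (x + 1)) := by
  induction k with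
  | zero => intro φ h x; simpa using h.2.2 x
  | succ k ih =>
    intro φ h x
    have hE := B_eq hS hn hL h hno
    set y := x + (k : ZMod (s + 2)) with hy
    have hyy : y + 1 ≠ y := by
      have := zadd_ne y (k := 1) (by omega) (by omega)
      simpa using this
    have := ih (φ ∘ Equiv.swap y (y + 1)) ⟨h.1, h.2.1.comp (Equiv.injective _), fun i => ?_⟩ x
    · rw [← hy] at this
      simp only [Function.comp, Equiv.swap_apply_left] at this
      push_cast
      rw [← add_assoc]
      exact this
    · simp only [Function.comp]
      by_cases h1 : i = y
      · rw [h1, Equiv.swap_apply_left]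
        have := (hE (y + 1)).2.1
        simpa using this
      by_cases h2 : i = y + 1
      · rw [h2, Equiv.swap_apply_right]
        have := (hE (y + 1 + 1)).2.2.1.symm
        simpa using this
      · rw [Equiv.swap_apply_of_ne_of_ne h1 h2]
        exact h.2.2 i

theorem B_solid' {V ι : Type*} [Fintype V] [Fintype ι] {G : ι → SimpleGraph V} (hS : Sig G)
    {s L : ℕ} (hn : Fintype.card V = s + 2) (hι : Fintype.card ι = s + 2) (hL : L + 2 ≤ s)
    {v : ZMod (s + 2) → V} {φ : ZMod (s + 2) → ι} (hcyc : IsRainbowCycle G v φ)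
    (hno : ¬ HasRainbowCycle G (L + 3)) (a : ι) (x : ZMod (s + 2)) :
    (G a).Adj (v x) (v (x + 1)) := by
  have hsur : Function.Surjective φ :=
    ((Fintype.bijective_iff_injective_and_card φ).2 ⟨hcyc.2.1, by rw [ZMod.card, hι]⟩).2
  obtain ⟨y, rfl⟩ := hsur a
  have := B_solid hS hn hL hno (y - x).val φ hcyc x
  simpa using this

theorem exists_equiv2 {α β : Type*} [Fintype α] [Fintype β] (h : Fintype.card α = Fintype.card β)
    {p q : α} {a b : β} (hpq : p ≠ q) (hab : a ≠ b) : ∃ e : α ≃ β, e p = a ∧ e q = b := by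
  have e0 : α ≃ β := Fintype.equivOfCardEq h
  set e1 := e0.trans (Equiv.swap (e0 p) a) with he1
  have h1 : e1 p = a := by simp [he1]
  refine ⟨e1.trans (Equiv.swap (e1 q) b), ?_, ?_⟩
  · rw [Equiv.trans_apply, h1, Equiv.swap_apply_of_ne_of_ne _ hab]
    rw [← h1]; exact fun h => hpq (e1.injective h)
  · simp

theorem B_flip {V ι : Type*} [Fintype V] [Fintype ι] {G : ι → SimpleGraph V} (hS : Sig G)
    {s L : ℕ} (hn : Fintype.card V = s + 2) (hι : Fintype.card ι = s + 2) (hL : L + 2 ≤ s)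
    {v : ZMod (s + 2) → V} {φ : ZMod (s + 2) → ι} (hcyc : IsRainbowCycle G v φ)
    (hno : ¬ HasRainbowCycle G (L + 3)) {a b : ι} (hab : a ≠ b) (r : ZMod (s + 2)) (i : ℕ)
    (hi : i < s) :
    (G a).Adj (v r) (v (r + ((i + 1 : ℕ) : ZMod (s + 2)))) ↔
      ¬ (G b).Adj (v (r - 1)) (v (r + (((i + L) % s + 1 : ℕ) : ZMod (s + 2)))) := by
  have hne : r + (i : ZMod (s + 2)) ≠ r + (((i + L) % s + 1 : ℕ) : ZMod (s + 2)) := by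
    intro h
    have hm := shift_lt (L := L) i hi
    have := zcast_inj (N := s + 2) (by omega) (by omega) (add_left_cancel h)
    by_cases hc : i + L < s
    · rw [Nat.mod_eq_of_lt hc] at this; omega
    · rw [Nat.mod_eq_sub_mod (by omega), Nat.mod_eq_of_lt (by omega)] at this; omega
  obtain ⟨e, ha, hb⟩ := exists_equiv2 (by rw [ZMod.card, hι]) hne hab
  have := (B_eq hS hn hL (v := v) (φ := e) ⟨hcyc.1, e.injective,
    fun x => B_solid' hS hn hι hL hcyc hno _ x⟩ hno r).2.2.2 i hi
  rwa [ha, hb] at this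

theorem B_same {V ι : Type*} [Fintype V] [Fintype ι] {G : ι → SimpleGraph V} (hS : Sig G)
    {s L : ℕ} (hn : Fintype.card V = s + 2) (hι : Fintype.card ι = s + 2) (hL : L + 2 ≤ s)
    {v : ZMod (s + 2) → V} {φ : ZMod (s + 2) → ι} (hcyc : IsRainbowCycle G v φ)
    (hno : ¬ HasRainbowCycle G (L + 3)) (a b : ι) : G a = G b := by
  have hsur : Function.Surjective v :=
    ((Fintype.bijective_iff_injective_and_card v).2 ⟨hcyc.1, by rw [ZMod.card, hn]⟩).2
  obtain ⟨c, hc⟩ : ∃ c, c ∉ ({a, b} : Finset ι) := by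
    by_contra hcon
    push Not at hcon
    have h1 := Finset.card_le_card (show Finset.univ ⊆ ({a, b} : Finset ι) from fun x _ => hcon x)
    have h2 := Finset.card_le_two (a := a) (b := b)
    rw [Finset.card_univ] at h1
    omega
  simp only [Finset.mem_insert, Finset.mem_singleton, not_or] at hc
  have hsol := fun p x => B_solid' hS hn hι hL hcyc hno p x
  ext u w
  obtain ⟨x, rfl⟩ := hsur u
  obtain ⟨y, rfl⟩ := hsur w
  obtain ⟨k, hk, rfl⟩ : ∃ k < s + 2, y = x + (k : ℕ) := ⟨(y - x).val, ZMod.val_lt _, by simp⟩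
  rcases k with _ | i
  · simp
  by_cases hi : i < s
  · rw [B_flip hS hn hι hL hcyc hno (Ne.symm hc.1) x i hi,
      B_flip hS hn hι hL hcyc hno (Ne.symm hc.2) x i hi]
  · obtain rfl : i = s := by omega
    rw [zlast]
    have h1 := (hsol a (x - 1)).symm
    have h2 := (hsol b (x - 1)).symm
    rw [sub_add_cancel] at h1 h2
    exact iff_of_true h1 h2

end
end Rb

namespace Rb

section
open scoped Classical

theorem cnt_congr {α : Type*} (s : Finset α) {P Q : α → Prop} (h : ∀ x ∈ s, (P x ↔ Q x)) :
    cnt s P = cnt s Q := by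
  rw [cnt_eq_sum, cnt_eq_sum]
  exact Finset.sum_congr rfl (fun x hx => by rw [propext (h x hx)])

theorem half_count (P : ℕ → Prop) (h1 : P 1) (h2 : ∀ k, P (2 * k + 2)) (m : ℕ) :
    m + 2 ≤ 2 * cnt (Finset.range (m + 2)) P := by
  induction m using Nat.twoStepInduction with
  | zero =>
    rw [cnt_succ, ind_pos h1]; omega
  | one =>
    have := ind_pos (h2 0)
    rw [show 2 * 0 + 2 = 2 from rfl] at this
    rw [cnt_succ, cnt_succ, ind_pos h1, this]; omega
  | more m ih _ =>
    rw [cnt_succ, cnt_succ]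
    rcases Nat.even_or_odd' m with ⟨k, hk | hk⟩
    · have := ind_pos (h2 k)
      rw [show m + 2 = 2 * k + 2 by omega] at ih ⊢
      omega
    · have := ind_pos (h2 (k + 1))
      rw [show m + 2 + 1 = 2 * (k + 1) + 2 by omega]
      omega

theorem even_count (m : ℕ) : cnt (Finset.range (2 * m)) (fun k => Even k) = m := by
  induction m with
  | zero => simp [cnt]
  | succ m ih =>
    rw [show 2 * (m + 1) = 2 * m + 1 + 1 by ring, cnt_succ, cnt_succ, ih,
      ind_pos (by simp), ind_neg (by simp)]

/-- degrees are at least `n/2`. -/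
theorem B_deg {V ι : Type*} [Fintype V] [Fintype ι] {G : ι → SimpleGraph V} (hS : Sig G)
    {s L : ℕ} (hn : Fintype.card V = s + 2) (hι : Fintype.card ι = s + 2) (hL : L + 2 ≤ s)
    {v : ZMod (s + 2) → V} {φ : ZMod (s + 2) → ι} (hcyc : IsRainbowCycle G v φ)
    (hno : ¬ HasRainbowCycle G (L + 3)) (p : ι) (u : V) : s + 2 ≤ 2 * dg G p u := by
  have hsur : Function.Surjective v :=
    ((Fintype.bijective_iff_injective_and_card v).2 ⟨hcyc.1, by rw [ZMod.card, hn]⟩).2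
  have hsame := fun q => B_same hS hn hι hL hcyc hno q p
  have hd : ∀ r, dg G p (v r) + dg G p (v (r - 1)) = s + 2 := by
    intro r
    have := (B_eq hS hn hL hcyc hno r).1
    simp only [hsame] at this
    rw [dg_cyc hn hcyc.1, dg_cyc hn hcyc.1]
    exact this
  obtain ⟨x, rfl⟩ := hsur u
  by_contra hlt
  have hd2 : ∀ k : ℕ, dg G p (v (x + ((2 * k : ℕ) : ZMod (s + 2)))) = dg G p (v x) := by
    intro k
    induction k with
    | zero => simp
    | succ k ih =>
      have h1 := hd (x + ((2 * k : ℕ) : ZMod (s + 2)) + 1 + 1)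
      have h2 := hd (x + ((2 * k : ℕ) : ZMod (s + 2)) + 1)
      rw [add_sub_cancel_right] at h1 h2
      rw [show x + ((2 * (k + 1) : ℕ) : ZMod (s + 2)) = x + ((2 * k : ℕ) : ZMod (s + 2)) + 1 + 1 by
        push_cast; ring]
      omega
  have hdx : dg G p (v x) = cnt (Finset.range (s + 2))
      (fun k => (G p).Adj (v x) (v (x + (k : ℕ)))) := by
    rw [dg_cyc hn hcyc.1, ← cnt_lin x]
  have hc := half_count (fun k => k < s + 2 → (G p).Adj (v x) (v (x + (k : ℕ)))) (by
    intro _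
    simpa using B_solid' hS hn hι hL hcyc hno p x) (by
    intro k hk
    by_contra hna
    have h1 := hS _ _ (fun h => zadd_ne x (by omega) hk (hcyc.1 h).symm) ⟨p, hna⟩ p p
    have h2 := hd2 (k + 1)
    rw [show 2 * (k + 1) = 2 * k + 2 by ring] at h2
    omega) s
  have he : cnt (Finset.range (s + 2)) (fun k => k < s + 2 → (G p).Adj (v x) (v (x + (k : ℕ)))) =
      cnt (Finset.range (s + 2)) (fun k => (G p).Adj (v x) (v (x + (k : ℕ)))) := by
    apply cnt_congr
    intro k hk
    simp at hk
    simp [hk]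
  rw [he, ← hdx] at hc
  exact hlt hc

/-- no cycle of length `n - 1`. -/
theorem B_no {V ι : Type*} [Fintype V] [Fintype ι] {G : ι → SimpleGraph V} (hS : Sig G)
    {s L : ℕ} (hn : Fintype.card V = s + 2) (hι : Fintype.card ι = s + 2) (hL : L + 2 ≤ s)
    {v : ZMod (s + 2) → V} {φ : ZMod (s + 2) → ι} (hcyc : IsRainbowCycle G v φ)
    (hno : ¬ HasRainbowCycle G (L + 3)) : ¬ HasRainbowCycle G (s + 1) := by
  rintro ⟨c, ψ, hc, hψ, hadj⟩
  have hsame := fun q p => B_same hS hn hι hL hcyc hno q p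
  obtain ⟨y, hy⟩ : ∃ s, ∀ i, c i ≠ s := by
    by_contra hcon
    push Not at hcon
    have := Fintype.card_le_of_surjective c hcon
    rw [ZMod.card] at this; omega
  obtain ⟨t, ht⟩ : ∃ s, ∀ i, ψ i ≠ s := by
    by_contra hcon
    push Not at hcon
    have := Fintype.card_le_of_surjective ψ hcon
    rw [ZMod.card] at this; omega
  have hd := B_deg hS hn hι hL hcyc hno t y
  unfold dg at hd
  rw [cnt_split hn hc hy, ind_neg (by simp)] at hd
  have e1 := cnt_lin (((L + 1 : ℕ)) : ZMod (s + 1)) (fun x => (G t).Adj y (c x))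
  have e2 := cnt_lin (0 : ZMod (s + 1)) (fun x => (G t).Adj y
    (c (x + ((L + 1 : ℕ) : ZMod (s + 1)))))
  simp only [zero_add, add_comm _ (((L + 1 : ℕ)) : ZMod (s + 1))] at e2
  obtain ⟨x, -, hx1, hx2⟩ := exists_both Finset.univ (fun x => (G t).Adj y (c x))
    (fun x => (G t).Adj y (c (((L + 1 : ℕ) : ZMod (s + 1)) + x))) (by
      rw [← e2, e1, Finset.card_univ, ZMod.card]; omega)
  apply hno
  have hC : Cyc (pull G (lf c y (x - 1)) (lf ψ t (x - 1))) (s + 2) (L + 3) := by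
    refine ⟨_, _, _, _, s + 1, (RW.seg' (a := 0) (b := L + 1) (by omega) ?_).append (c := L + 1) ?_
      (RW.nil (s + 1)), ?_, ?_, ?_, ?_, ?_, ?_⟩
    · intro j _ hj
      simp only [pull, SimpleGraph.comap_adj]
      rw [lf_le _ _ _ (by omega), lf_le _ _ _ (by omega), lf_le _ _ _ (by omega)]
      push_cast
      rw [← add_assoc]; exact hadj _
    · simp only [pull, SimpleGraph.comap_adj]
      rw [lf_y, lf_le c _ _ (by omega), hsame _ t, sub_add_cancel, add_comm x]
      exact hx2.symm
    · simp only [pull, SimpleGraph.comap_adj]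
      rw [hsame _ t, lf_y, lf_0, sub_add_cancel]
      exact hx1
    · simp [List.nodup_append, List.nodup_range']; (repeat' (first | apply And.intro | intro _)) <;> omega
    · simp [List.nodup_append, List.nodup_range']; (repeat' (first | apply And.intro | intro _)) <;> omega
    · simp; (repeat' (first | apply And.intro | intro _)) <;> omega
    · simp; (repeat' (first | apply And.intro | intro _)) <;> omega
    · simp
  obtain ⟨c', φ', h, _⟩ := close G _ _ (lf_inj hc hy (x - 1)) (lf_inj hψ ht (x - 1)) hC
  exact ⟨c', φ', h⟩

theorem partB {V ι : Type*} [Fintype V] [Fintype ι] {G : ι → SimpleGraph V} (hS : Sig G)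
    {s L : ℕ} (hn : Fintype.card V = s + 2) (hι : Fintype.card ι = s + 2) (hL : L + 2 ≤ s)
    {v : ZMod (s + 2) → V} {φ : ZMod (s + 2) → ι} (hcyc : IsRainbowCycle G v φ)
    (hno : ¬ HasRainbowCycle G (L + 3)) :
    Even (s + 2) ∧ ∃ A : Finset V, 2 * A.card = s + 2 ∧
      ∀ (i : ι) (u w : V), (G i).Adj u w ↔ ((u ∈ A ∧ w ∉ A) ∨ (u ∉ A ∧ w ∈ A)) := by
  have hno' := B_no hS hn hι hL hcyc hno
  obtain ⟨S, rfl⟩ : ∃ S, s = S + 2 := ⟨s - 2, by omega⟩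
  have hsame := fun q p => B_same hS hn hι hL hcyc hno q p
  have hsol := fun q p => B_solid' hS hn hι hL hcyc hno q p
  have hnt : Nontrivial ι := Fintype.one_lt_card_iff_nontrivial.1 (by omega)
  obtain ⟨a, b, hab⟩ := hnt
  have hflip := fun r i hi => B_flip hS hn hι (L := S) le_rfl hcyc hno' hab r i hi
  rw [hsame b a] at hflip
  have hch := fun r => B_chord' (L := S) le_rfl hcyc hno' r
  simp only [hsame _ a] at hch
  have hz : ((S + 2 + 2 : ℕ) : ZMod (S + 2 + 2)) = 0 := ZMod.natCast_self _
  have h2 : ∀ r, ¬ (G a).Adj (v r) (v (r + ((2 : ℕ) : ZMod (S + 2 + 2)))) := by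
    intro r h
    apply hch (r + ((2 : ℕ) : ZMod (S + 2 + 2)))
    rw [show r + ((2 : ℕ) : ZMod (S + 2 + 2)) + ((S + 2 : ℕ) : ZMod (S + 2 + 2)) = r by
      push_cast at hz ⊢; linear_combination hz]
    exact h
  have hgap : ∀ k, k < S + 2 → ∀ r, ((G a).Adj (v r) (v (r + ((k + 1 : ℕ) : ZMod (S + 2 + 2)))) ↔
      Odd (k + 1)) := by
    intro k
    induction k with
    | zero => intro _ r; simpa using hsol a r
    | succ k ih =>
      intro hk r
      rcases Nat.eq_zero_or_pos k with rfl | hk0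
      · exact iff_of_false (h2 r) (by decide)
      · have hf := hflip r (k + 1) hk
        rw [Nat.mod_eq_sub_mod (by omega), Nat.mod_eq_of_lt (by omega)] at hf
        have hi := ih (by omega) (r - 1)
        rw [show r - 1 + ((k + 1 : ℕ) : ZMod (S + 2 + 2)) = r + (k : ℕ) by push_cast; ring] at hi
        rw [show k + 1 + S - (S + 2) + 1 = k by omega] at hf
        rw [hf, hi, Nat.not_odd_iff_even, Nat.odd_add_one, Nat.not_odd_iff_even]
  have heven : Even (S + 2) := by
    by_contra hodd
    rw [Nat.not_even_iff_odd] at hodd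
    exact hch 0 ((hgap (S + 1) (by omega) 0).2 hodd).symm
  have hall : ∀ k, k < S + 2 + 2 → ∀ r, ((G a).Adj (v r) (v (r + (k : ℕ))) ↔ Odd k) := by
    intro k hk r
    rcases k with _ | k
    · simp
    by_cases h : k < S + 2
    · exact hgap k h r
    · obtain rfl : k = S + 2 := by omega
      rw [zlast]
      refine iff_of_true ?_ (by rw [Nat.odd_add_one, Nat.not_odd_iff_even]; exact heven)
      have := (hsol a (r - 1)).symm
      rwa [sub_add_cancel] at this
  set e : ZMod (S + 2 + 2) ≃ V := Equiv.ofBijective v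
    ((Fintype.bijective_iff_injective_and_card v).2 ⟨hcyc.1, by rw [ZMod.card, hn]⟩) with he
  have hev : ∀ x, e x = v x := fun x => rfl
  have hsy : ∀ x, e.symm (v x) = x := fun x => by rw [← hev, Equiv.symm_apply_apply]
  refine ⟨by obtain ⟨m, hm⟩ := heven; exact ⟨m + 1, by omega⟩,
    Finset.univ.filter (fun w => Even (e.symm w).val), ?_, ?_⟩
  · have h1 := cnt_img hn (fun k : ℕ => v (0 + (k : ℕ))) (zlin_inj hcyc.1 0)
      (fun w => Even (e.symm w).val)
    obtain ⟨m, hm⟩ := heven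
    have h3 : cnt (Finset.range (S + 2 + 2)) (fun k => Even k) = m + 1 := by
      rw [show S + 2 + 2 = 2 * (m + 1) by omega]; exact even_count _
    have h4 : cnt (Finset.range (S + 2 + 2)) (fun k : ℕ => Even (e.symm (v (0 + (k : ℕ)))).val) =
        cnt (Finset.range (S + 2 + 2)) (fun k => Even k) := by
      apply cnt_congr
      intro k hk
      rw [Finset.mem_range] at hk
      rw [hsy, zero_add, ZMod.val_natCast_of_lt hk]
    rw [h4, h3] at h1
    have h5 : 2 * (m + 1) = S + 2 + 2 := by omega
    rw [h1] at h5
    unfold cnt at h5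
    convert h5
  · intro i u w
    rw [hsame i a]
    obtain ⟨x, rfl⟩ := e.surjective u
    obtain ⟨y, rfl⟩ := e.surjective w
    simp only [Finset.mem_filter, Finset.mem_univ, true_and, Equiv.symm_apply_apply, hev, hsy]
    have hk := hall (y - x).val (ZMod.val_lt _) x
    rw [ZMod.natCast_zmod_val, add_sub_cancel] at hk
    rw [hk]
    have hv : y.val = ((y - x).val + x.val) % (S + 2 + 2) := by
      rw [← ZMod.val_add, sub_add_cancel]
    have hb1 := ZMod.val_lt (y - x)
    have hb2 := ZMod.val_lt x
    have hcase : y.val = (y - x).val + x.val ∨ y.val + (S + 2 + 2) = (y - x).val + x.val := by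
      by_cases hc : (y - x).val + x.val < S + 2 + 2
      · left; rw [hv, Nat.mod_eq_of_lt hc]
      · right
        rw [Nat.mod_eq_sub_mod (by omega), Nat.mod_eq_of_lt (by omega)] at hv
        omega
    simp only [Nat.even_iff, Nat.odd_iff] at *
    omega

end
end Rb

theorem stmt1 {V : Type*} [Fintype V] {n : ℕ} (hn : 3 ≤ n)
    (hV : Fintype.card V = n)
    (G : ZMod n → SimpleGraph V) [∀ i, DecidableRel (G i).Adj]
    (hσ : ∀ u v : V, u ≠ v → (∃ i, ¬ (G i).Adj u v) →
      ∀ p q, n ≤ (G p).degree u + (G q).degree v) :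
    (∀ ℓ : ℕ, 3 ≤ ℓ → ℓ ≤ n → HasRainbowCycle G ℓ) ∨
    (Even n ∧ ∃ A : Finset V, 2 * A.card = n ∧
      ∀ (i : ZMod n) (u v : V), (G i).Adj u v ↔
        ((u ∈ A ∧ v ∉ A) ∨ (u ∉ A ∧ v ∈ A))) := by
  obtain ⟨s, rfl⟩ : ∃ s, n = s + 2 := ⟨n - 2, by omega⟩
  have hdeg : ∀ p u, (G p).degree u = Rb.dg G p u := by
    intro p u
    unfold Rb.dg Rb.cnt
    rw [← SimpleGraph.card_neighborFinset_eq_degree]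
    congr 1
    ext w
    simp
  have hS : Rb.Sig G := by
    intro u v huv hex p q
    rw [hV, ← hdeg, ← hdeg]
    exact hσ u v huv hex p q
  have hι : Fintype.card (ZMod (s + 2)) = s + 2 := ZMod.card _
  obtain ⟨v, φ, hcyc⟩ := Rb.partA hV hι (by omega) G hS
  by_cases hall : ∀ ℓ : ℕ, 3 ≤ ℓ → ℓ ≤ s + 2 → HasRainbowCycle G ℓ
  · exact Or.inl hall
  right
  push Not at hall
  obtain ⟨ℓ, h3, hle, hno⟩ := hall
  obtain ⟨L, rfl⟩ : ∃ L, ℓ = L + 3 := ⟨ℓ - 3, by omega⟩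
  have hne : L + 3 ≠ s + 2 := by
    intro h
    rw [h] at hno
    exact hno ⟨v, φ, hcyc⟩
  exact Rb.partB hS hV hι (by omega) hcyc hno
end
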